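/- Let N ∈ {1,2,4} and let λ ≥ 0 be an integer. Let f be a weakly holomorphic modular form of weight λ+1/2 on Γ₀(4N) such that every Fourier coefficient a_f(n) at ∞ lies in L and is 𝔭-integral, where 𝔭 divides p = 2, and such that the constant term of f at every cusp vanishes, i.e. c_σ(0) = 0 for every σ ∈ SL₂(ℤ). Then for every positive integer j there exists a positive integer b such that a_f(2^b·n) ≡ 0 (mod 𝔭^j) for every integer n. -/

import Mathlib

open Complex UpperHalfPlane Matrix MatrixGroups CongruenceSubgroup Filter Topology Manifold
open scoped Real NumberField

set_option synthInstance.maxHeartbeats 1000000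
set_option maxHeartbeats 1000000

noncomputable section

/-- The Jacobi theta function `θ(τ) = Σ_{n ∈ ℤ} e^{2πin²τ}`. -/
def Theta (τ : ℍ) : ℂ := ∑' n : ℤ, Complex.exp (2 * Real.pi * Complex.I * (n : ℂ) ^ 2 * (τ : ℂ))

/-- `cτ + d` for `σ = (a,b;c,d) ∈ SL₂(ℤ)`. -/
def denomC (σ : SL(2, ℤ)) (τ : ℍ) : ℂ := (σ 1 0 : ℂ) * (τ : ℂ) + (σ 1 1 : ℂ)

/-- `f` admits at the cusp `σ∞` an expansion `(cτ+d)^{-k} f(στ) = Σ_n c(n) e^{2πinτ/M}`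
(principal branch) with coefficients `c`, width `M > 0`, coefficients vanishing below some `s₀`,
the series converging absolutely, and uniformly on `{Im τ ≥ y₀}` for every `y₀ > 0`. -/
def CuspExpansion (k : ℂ) (f : ℍ → ℂ) (σ : SL(2, ℤ)) (M : ℕ) (c : ℤ → ℂ) : Prop :=
  0 < M ∧ (∃ s₀ : ℤ, ∀ n : ℤ, n < s₀ → c n = 0) ∧
  ∀ y₀ : ℝ, 0 < y₀ →
    (∀ τ : ℍ, y₀ ≤ τ.im →
      Summable fun n : ℤ => ‖c n * Complex.exp (2 * Real.pi * Complex.I * n * τ / M)‖) ∧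
    TendstoUniformlyOn
      (fun (s : Finset ℤ) (τ : ℍ) =>
        ∑ n ∈ s, c n * Complex.exp (2 * Real.pi * Complex.I * n * τ / M))
      (fun τ => (denomC σ τ) ^ (-k) * f (σ • τ))
      Filter.atTop {τ : ℍ | y₀ ≤ τ.im}

/-- Weakly holomorphic modular form of weight `lam + 1/2` on `Γ₀(4N)`. -/
structure IsWeaklyHolo (N : ℕ) (lam : ℤ) (f : ℍ → ℂ) : Prop where
  holo : MDifferentiable 𝓘(ℂ) 𝓘(ℂ) f
  transf : ∀ γ ∈ Gamma0 (4 * N), ∀ τ : ℍ,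
    f (γ • τ) = (Theta (γ • τ) / Theta τ) ^ (2 * lam + 1 : ℤ) * f τ
  cusp : ∀ σ : SL(2, ℤ), ∃ (M : ℕ) (c : ℤ → ℂ), CuspExpansion ((lam : ℂ) + 1 / 2) f σ M c

/-- Holomorphic modular form of weight `lam + 1/2` on `Γ₀(4N)`: at every cusp one can take the
expansion to start at `0`. -/
structure IsHoloForm (N : ℕ) (lam : ℤ) (f : ℍ → ℂ) : Prop where
  holo : MDifferentiable 𝓘(ℂ) 𝓘(ℂ) f
  transf : ∀ γ ∈ Gamma0 (4 * N), ∀ τ : ℍ,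
    f (γ • τ) = (Theta (γ • τ) / Theta τ) ^ (2 * lam + 1 : ℤ) * f τ
  cusp : ∀ σ : SL(2, ℤ), ∃ (M : ℕ) (c : ℤ → ℂ),
    CuspExpansion ((lam : ℂ) + 1 / 2) f σ M c ∧ ∀ n : ℤ, n < 0 → c n = 0

/-- Cusp form of weight `lam + 1/2` on `Γ₀(4N)`: holomorphic form all of whose slashes tend to
`0` as `Im τ → ∞`. -/
structure IsCuspFormHalf (N : ℕ) (lam : ℤ) (f : ℍ → ℂ) : Prop where
  toIsHoloForm : IsHoloForm N lam f
  decay : ∀ σ : SL(2, ℤ),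
    Filter.Tendsto (fun τ : ℍ => (denomC σ τ) ^ (-((lam : ℂ) + 1 / 2)) * f (σ • τ))
      (Filter.comap UpperHalfPlane.im Filter.atTop) (nhds 0)

/-- `f(τ) = Σ_{n ∈ ℤ} a(n) e^{2πinτ}` is the Fourier expansion of `f` at `∞`. -/
def FourierAtInfty (f : ℍ → ℂ) (a : ℤ → ℂ) : Prop :=
  ∀ τ : ℍ, HasSum (fun n : ℤ => a n * Complex.exp (2 * Real.pi * Complex.I * n * τ)) (f τ)

/-- `x ≡ y (mod 𝔭^j)` for elements of `ℂ` lying in `L`: `(x - y)·b = a` with `a ∈ 𝔭^j`,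
`b ∉ 𝔭`, i.e. `v_𝔭(x - y) ≥ j`. -/
def CongMod (L : Subfield ℂ) (P : Ideal (𝓞 L)) (j : ℕ) (x y : ℂ) : Prop :=
  ∃ a b : 𝓞 L, a ∈ P ^ j ∧ b ∉ P ∧ (x - y) * ((b : L) : ℂ) = ((a : L) : ℂ)

/-- `x` is `𝔭`-integral: `x·b = a` with `a ∈ 𝒪_L`, `b ∈ 𝒪_L ∖ 𝔭`. -/
def PIntegral (L : Subfield ℂ) (P : Ideal (𝓞 L)) (x : ℂ) : Prop :=
  ∃ a b : 𝓞 L, b ∉ P ∧ x * ((b : L) : ℂ) = ((a : L) : ℂ)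

section FormalTheta

open LaurentPolynomial

variable {K : Type*} [CommRing K]

/-- The substitution `q ↦ q⁴` on Laurent series. -/
def qFour (K : Type*) [CommRing K] : LaurentSeries K →+* LaurentSeries K :=
  HahnSeries.embDomainRingHom (AddMonoidHom.mulLeft (4 : ℤ))
    (fun _ _ h => by simpa using h) (fun _ _ => by simp)

lemma qFour_coeff (f : LaurentSeries K) (n : ℤ) : (qFour K f).coeff (4 * n) = f.coeff n :=
  HahnSeries.embDomain_coeff (f := ⟨⟨AddMonoidHom.mulLeft (4 : ℤ), _⟩, _⟩) (a := n)

lemma qFour_coeff_of_not_dvd (f : LaurentSeries K) {n : ℤ} (hn : ¬ (4 : ℤ) ∣ n) :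
    (qFour K f).coeff n = 0 := by
  refine HahnSeries.embDomain_notin_image_support ?_
  rintro ⟨k, -, hk⟩
  exact hn ⟨k, hk.symm⟩

/-- `f` is supported on exponents congruent to `i` modulo `4`. -/
def IsGradedMod4 (i : ZMod 4) (f : LaurentSeries K) : Prop :=
  ∀ n : ℤ, f.coeff n ≠ 0 → (n : ZMod 4) = i

lemma IsGradedMod4.mul {i j : ZMod 4} {f g : LaurentSeries K} (hf : IsGradedMod4 i f)
    (hg : IsGradedMod4 j g) : IsGradedMod4 (i + j) (f * g) := by
  intro n hn
  rw [HahnSeries.coeff_mul] at hn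
  obtain ⟨⟨u, v⟩, huv, hne⟩ := Finset.exists_ne_zero_of_sum_ne_zero hn
  rw [Finset.mem_antidiagonal] at huv
  rw [← huv.2.2, Int.cast_add, hf u (left_ne_zero_of_mul hne), hg v (right_ne_zero_of_mul hne)]

lemma isGradedMod4_one : IsGradedMod4 0 (1 : LaurentSeries K) := by
  intro n hn
  rw [HahnSeries.coeff_one] at hn
  have : n = 0 := by by_contra h; simp [h] at hn
  simp [this]

lemma IsGradedMod4.pow {i : ZMod 4} {f : LaurentSeries K} (hf : IsGradedMod4 i f) (r : ℕ) :
    IsGradedMod4 (r * i) (f ^ r) := by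
  induction r with
  | zero => simpa using isGradedMod4_one
  | succ r ih =>
    rw [pow_succ]
    convert ih.mul hf using 1
    push_cast; ring

lemma isGradedMod4_qFour (f : LaurentSeries K) : IsGradedMod4 0 (qFour K f) := by
  intro n hn
  by_contra h
  exact hn (qFour_coeff_of_not_dvd f fun hd => h ((ZMod.intCast_zmod_eq_zero_iff_dvd n 4).2 hd))

/-- A pair of Laurent series satisfying the identities relating `θ(4τ)` and
`∑ q^((2n+1)²)` at `τ` and `4τ`. -/
structure ThetaPair (K : Type*) [CommRing K] where
  a : (LaurentSeries K)ˣ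
  b : (LaurentSeries K)ˣ
  a_eq : (a : LaurentSeries K) = qFour K (a + 2 * b)
  b_pow : (b : LaurentSeries K) ^ 4 = qFour K (a * b * (a ^ 2 + 4 * b ^ 2))
  b_graded : IsGradedMod4 1 (b : LaurentSeries K)
  nilp : IsNilpotent (2 : K)

namespace ThetaPair

variable (θ : ThetaPair K)

/-- The quotient `b / a`. -/
def t : (LaurentSeries K)ˣ := θ.b * θ.a⁻¹

/-- Evaluation of Laurent polynomials at `t = b / a`. -/
def ev : K[T;T⁻¹] →+* LaurentSeries K := LaurentPolynomial.eval₂ HahnSeries.C θ.t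

lemma ev_T (n : ℤ) : θ.ev (T n) = ((θ.t ^ n : (LaurentSeries K)ˣ) : LaurentSeries K) := by
  simp [ev, LaurentPolynomial.eval₂_T]

lemma ev_C (c : K) : θ.ev (C c) = HahnSeries.C c := LaurentPolynomial.eval₂_C _ _ _

lemma isNilpotent_two_mul (θ : ThetaPair K) (x : K[T;T⁻¹]) : IsNilpotent (2 * x) := by
  have h2 : IsNilpotent (2 : K[T;T⁻¹]) := by
    have := θ.nilp.map (C : K →+* K[T;T⁻¹])
    rwa [map_ofNat] at this
  exact (Commute.all _ _).isNilpotent_mul_right h2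

/-- The unit `1 + 2x`. -/
def onePlus (x : K[T;T⁻¹]) : K[T;T⁻¹]ˣ := (θ.isNilpotent_two_mul x).isUnit_one_add.unit

lemma onePlus_val (x : K[T;T⁻¹]) : (θ.onePlus x : K[T;T⁻¹]) = 1 + 2 * x := IsUnit.unit_spec _

/-- The unit `1 + 2T`. -/
def u₁ : K[T;T⁻¹]ˣ := θ.onePlus (T 1)

/-- The unit `1 + 4T²`. -/
def u₂ : K[T;T⁻¹]ˣ := θ.onePlus (2 * T 1 ^ 2)

/-- The subgroup of units congruent to `1` modulo `2`. -/
def unitsOne (R : Type*) [CommRing R] : Subgroup Rˣ :=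
  (Units.map (Ideal.Quotient.mk (Ideal.span {(2 : R)})).toMonoidHom).ker

lemma mem_unitsOne {R : Type*} [CommRing R] {u : Rˣ} :
    u ∈ unitsOne R ↔ (2 : R) ∣ (u : R) - 1 := by
  rw [unitsOne, MonoidHom.mem_ker, Units.ext_iff, ← Ideal.mem_span_singleton,
    ← Ideal.Quotient.eq]
  simp

lemma onePlus_mem (x : K[T;T⁻¹]) : θ.onePlus x ∈ unitsOne K[T;T⁻¹] := by
  rw [mem_unitsOne, onePlus_val]
  exact ⟨x, by ring⟩

variable (m : ℕ)

/-- The image of `T ^ k` under the operator induced by `U₄` on `a ^ m • K[t, t⁻¹]`. -/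
def opUT (k : ℤ) : K[T;T⁻¹] :=
  if 4 ∣ k then T (k / 4) * ((θ.u₁ ^ ((m : ℤ) - k) * θ.u₂ ^ (k / 4) : K[T;T⁻¹]ˣ) : K[T;T⁻¹]) else 0

/-- The operator induced by `U₄` on `a ^ m • K[t, t⁻¹]`. -/
def opU : K[T;T⁻¹] →ₗ[K] K[T;T⁻¹] :=
  Finsupp.linearCombination K (θ.opUT m) ∘ₗ (AddMonoidAlgebra.coeffLinearEquiv K).toLinearMap

lemma opU_T (k : ℤ) : θ.opU m (T k) = θ.opUT m k := by
  change Finsupp.linearCombination K (θ.opUT m) (Finsupp.single k 1) = _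
  rw [Finsupp.linearCombination_single, one_smul]

/-- The form `a ^ m g(t)`. -/
def form : K[T;T⁻¹] →ₗ[K] LaurentSeries K where
  toFun g := (θ.a : LaurentSeries K) ^ m * θ.ev g
  map_add' := by intros; simp [mul_add]
  map_smul' c g := by
    simp only [LaurentPolynomial.smul_eq_C_mul, map_mul, ev_C, RingHom.id_apply,
      ← HahnSeries.C_mul_eq_smul]
    ring

lemma form_apply (g : K[T;T⁻¹]) : θ.form m g = (θ.a : LaurentSeries K) ^ m * θ.ev g := rfl

lemma linearMap_ext_T {M : Type*} [AddCommGroup M] [Module K M] {f g : K[T;T⁻¹] →ₗ[K] M}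
    (h : ∀ k, f (T k) = g (T k)) : f = g := by
  refine LinearMap.ext fun p => ?_
  induction p using LaurentPolynomial.induction_on' with
  | add p q hp hq => rw [map_add, map_add, hp, hq]
  | C_mul_T n a => rw [← LaurentPolynomial.smul_eq_C_mul, map_smul, map_smul, h]

/-- `q ↦ q⁴` on units. -/
abbrev qFourU : (LaurentSeries K)ˣ →* (LaurentSeries K)ˣ := Units.map (qFour K).toMonoidHom

lemma ev_u₁ : θ.ev θ.u₁ = 1 + 2 * (θ.t : LaurentSeries K) := by
  simp only [u₁, onePlus_val, map_add, map_mul, ev_T, map_one, map_ofNat]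
  rw [_root_.zpow_one]

lemma ev_u₂ : θ.ev θ.u₂ = 1 + 4 * (θ.t : LaurentSeries K) ^ 2 := by
  simp only [u₂, onePlus_val, map_add, map_mul, map_pow, ev_T, map_one, map_ofNat]
  rw [_root_.zpow_one]; ring

lemma t_mul_a : (θ.t : LaurentSeries K) * θ.a = θ.b := by simp [t]

/-- `ev` on units. -/
abbrev evU : K[T;T⁻¹]ˣ →* (LaurentSeries K)ˣ := Units.map θ.ev.toMonoidHom

lemma a_eq_unit : θ.a = qFourU (θ.a * θ.evU θ.u₁) := by
  ext1
  rw [θ.a_eq]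
  simp only [Units.coe_map, Units.val_mul, RingHom.toMonoidHom_eq_coe, MonoidHom.coe_coe, ev_u₁]
  rw [← θ.t_mul_a]; congr 1; ring

lemma b_pow_unit : θ.b ^ 4 = qFourU (θ.a ^ 4 * θ.t * θ.evU θ.u₂) := by
  ext1
  rw [Units.val_pow_eq_pow_val, θ.b_pow]
  simp only [Units.coe_map, Units.val_mul, RingHom.toMonoidHom_eq_coe, MonoidHom.coe_coe, ev_u₂,
    Units.val_pow_eq_pow_val]
  rw [← θ.t_mul_a]; congr 1; ring

lemma form_T (k : ℤ) : θ.form m (T k) = ((θ.a ^ ((m : ℤ) - k) * θ.b ^ k : (LaurentSeries K)ˣ) :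
    LaurentSeries K) := by
  rw [form_apply, ev_T, ← Units.val_pow_eq_pow_val, ← Units.val_mul]
  congr 1
  rw [t, _root_.mul_zpow, _root_.zpow_sub, _root_.zpow_natCast, _root_.inv_zpow]
  exact mul_left_comm _ _ _ |>.trans (mul_comm _ _)

lemma form_T_of_dvd (r : ℤ) : θ.form m (T (4 * r)) = qFour K (θ.form m (θ.opUT m (4 * r))) := by
  have h : θ.form m (θ.opUT m (4 * r)) = ((θ.a ^ (m : ℤ) * (θ.t ^ r *
      (θ.evU θ.u₁ ^ ((m : ℤ) - 4 * r) * θ.evU θ.u₂ ^ r)) : (LaurentSeries K)ˣ) :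
        LaurentSeries K) := by
    rw [form_apply, opUT, if_pos (dvd_mul_right _ _), Int.mul_ediv_cancel_left _ (by norm_num),
      map_mul, ev_T, _root_.zpow_natCast, Units.val_mul, Units.val_mul, Units.val_pow_eq_pow_val,
      ← _root_.map_zpow, ← _root_.map_zpow, ← map_mul]
    rfl
  have h' : (θ.a ^ ((m : ℤ) - 4 * r) * θ.b ^ (4 * r)) = qFourU (θ.a ^ (m : ℤ) * (θ.t ^ r *
      (θ.evU θ.u₁ ^ ((m : ℤ) - 4 * r) * θ.evU θ.u₂ ^ r))) := by
    have hb : θ.b ^ (4 * r) = (θ.b ^ 4) ^ r := by rw [_root_.zpow_mul]; rfl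
    rw [hb, b_pow_unit]
    conv_lhs => enter [1]; rw [a_eq_unit]
    rw [← _root_.map_zpow, ← _root_.map_zpow, ← map_mul]
    congr 1
    have ha : (θ.a ^ 4) ^ r = θ.a ^ (4 * r) := by rw [_root_.zpow_mul]; rfl
    rw [_root_.mul_zpow, _root_.mul_zpow, _root_.mul_zpow, ha, _root_.zpow_sub θ.a]
    generalize θ.a ^ (4 * r) = x
    generalize θ.a ^ (m : ℤ) = y
    generalize θ.t ^ r = z
    generalize θ.evU θ.u₁ ^ ((m : ℤ) - 4 * r) = w
    generalize θ.evU θ.u₂ ^ r = v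
    rw [← mul_assoc, ← mul_assoc, mul_right_comm (y * x⁻¹) w x, inv_mul_cancel_right,
      mul_right_comm y w z, mul_assoc, mul_assoc]
  rw [form_T, h', h]
  rfl

lemma coeff_form_T_of_not_dvd {k : ℤ} (hk : ¬ (4 : ℤ) ∣ k) (n : ℤ) :
    (θ.form m (T k)).coeff (4 * n) = 0 := by
  obtain ⟨r, i, hi, hi0, rfl⟩ : ∃ (r : ℤ) (i : ℕ), i < 4 ∧ i ≠ 0 ∧ k = 4 * r + i :=
    ⟨k / 4, (k % 4).toNat, by omega, by omega, by omega⟩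
  have h : (θ.a ^ ((m : ℤ) - (4 * r + i)) * θ.b ^ (4 * r + (i : ℤ))) =
      qFourU ((θ.a * θ.evU θ.u₁) ^ ((m : ℤ) - (4 * r + i)) *
        (θ.a ^ 4 * θ.t * θ.evU θ.u₂) ^ r) * θ.b ^ i := by
    have hb : θ.b ^ (4 * r) = (θ.b ^ 4) ^ r := by rw [_root_.zpow_mul]; rfl
    rw [_root_.zpow_add θ.b, _root_.zpow_natCast, hb, b_pow_unit]
    conv_lhs => enter [1]; rw [a_eq_unit]
    rw [← mul_assoc, ← _root_.map_zpow, ← _root_.map_zpow, ← map_mul]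
  have hg := (isGradedMod4_qFour (((θ.a * θ.evU θ.u₁) ^ ((m : ℤ) - (4 * r + i)) *
    (θ.a ^ 4 * θ.t * θ.evU θ.u₂) ^ r : (LaurentSeries K)ˣ) : LaurentSeries K)).mul
      (θ.b_graded.pow i)
  by_contra hne
  rw [form_T, h, Units.val_mul, Units.val_pow_eq_pow_val] at hne
  have := hg _ hne
  push_cast at this
  rw [show (4 : ZMod 4) = 0 from rfl] at this
  interval_cases i <;> revert this <;> simp at hi0 ⊢ <;> decide

/-- `U₄` acts on forms through `opU`. -/
lemma coeff_four_mul_form (g : K[T;T⁻¹]) (n : ℤ) :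
    (θ.form m g).coeff (4 * n) = (θ.form m (θ.opU m g)).coeff n := by
  let c (n : ℤ) : LaurentSeries K →ₗ[K] K :=
    { toFun := fun f => f.coeff n, map_add' := fun _ _ => rfl, map_smul' := fun _ _ => rfl }
  suffices h : c (4 * n) ∘ₗ θ.form m = c n ∘ₗ θ.form m ∘ₗ θ.opU m from LinearMap.congr_fun h g
  refine linearMap_ext_T fun k => ?_
  simp only [LinearMap.comp_apply, opU_T]
  change (θ.form m (T k)).coeff (4 * n) = (θ.form m (θ.opUT m k)).coeff n
  by_cases hk : 4 ∣ k
  · obtain ⟨r, rfl⟩ := hk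
    rw [form_T_of_dvd, qFour_coeff]
  · rw [coeff_form_T_of_not_dvd _ _ hk, opUT, if_neg hk]; simp

end ThetaPair

end FormalTheta

section FormalThetaCongruence

open LaurentPolynomial

variable {K : Type*} [CommRing K]

lemma linearMap_mem_smul_top {M M' : Type*} [AddCommGroup M] [Module K M] [AddCommGroup M']
    [Module K M'] (φ : M →ₗ[K] M') {J : Ideal K} {h : M} (hh : h ∈ J • (⊤ : Submodule K M)) :
    φ h ∈ J • (⊤ : Submodule K M') := by
  refine Submodule.smul_induction_on hh (fun x hx y _ => ?_) (fun x y hx hy => ?_)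
  · rw [map_smul]; exact Submodule.smul_mem_smul hx trivial
  · rw [map_add]; exact add_mem hx hy

namespace ThetaPair

variable (θ : ThetaPair K) (m : ℕ) {I : Ideal K}

lemma unitsOne_sub_mem (h2 : (2 : K) ∈ I) {u : K[T;T⁻¹]ˣ} (hu : u ∈ unitsOne K[T;T⁻¹])
    (r : ℤ) : T r * (u : K[T;T⁻¹]) - T r ∈ I • (⊤ : Submodule K K[T;T⁻¹]) := by
  obtain ⟨v, hv⟩ := mem_unitsOne.1 hu
  have : T r * (u : K[T;T⁻¹]) - T r = (2 : K) • (T r * v) := by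
    rw [LaurentPolynomial.smul_eq_C_mul, map_ofNat]
    linear_combination T r * hv
  rw [this]
  exact Submodule.smul_mem_smul h2 trivial

lemma opU_T_mul_four_sub_mem (h2 : (2 : K) ∈ I) (r : ℤ) :
    θ.opU m (T (4 * r)) - T r ∈ I • (⊤ : Submodule K K[T;T⁻¹]) := by
  rw [opU_T, opUT, if_pos (dvd_mul_right _ _), Int.mul_ediv_cancel_left _ (by norm_num)]
  exact unitsOne_sub_mem h2 (mul_mem (zpow_mem (θ.onePlus_mem _) _)
    (zpow_mem (θ.onePlus_mem _) _)) r

lemma opU_pow_mem {J : Ideal K} {g : K[T;T⁻¹]} (hg : g ∈ J • (⊤ : Submodule K K[T;T⁻¹])) (b : ℕ) :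
    (θ.opU m ^ b) g ∈ J • (⊤ : Submodule K K[T;T⁻¹]) :=
  linearMap_mem_smul_top _ hg

lemma opU_pow_one_sub_mem (h2 : (2 : K) ∈ I) (b : ℕ) :
    (θ.opU m ^ b) 1 - 1 ∈ I • (⊤ : Submodule K K[T;T⁻¹]) := by
  induction b with
  | zero => simp
  | succ b ih =>
    have h1 := θ.opU_T_mul_four_sub_mem m h2 0
    rw [mul_zero, T_zero] at h1
    have := add_mem (θ.opU_pow_mem m h1 b) ih
    rw [map_sub, ← Module.End.mul_apply, ← pow_succ] at this
    simpa using this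

lemma exists_opU_pow_T_mem (h2 : (2 : K) ∈ I) (n : ℕ) (k : ℤ) (hk : k ≠ 0) (hn : k.natAbs ≤ n) :
    ∃ b, (θ.opU m ^ b) (T k) ∈ I • (⊤ : Submodule K K[T;T⁻¹]) := by
  induction n generalizing k with
  | zero => omega
  | succ n ih =>
    by_cases h4 : 4 ∣ k
    · obtain ⟨r, rfl⟩ := h4
      obtain ⟨b, hb⟩ := ih r (by omega) (by omega)
      refine ⟨b + 1, ?_⟩
      have := add_mem (θ.opU_pow_mem m (θ.opU_T_mul_four_sub_mem m h2 r) b) hb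
      rw [map_sub, sub_add_cancel] at this
      rwa [pow_succ, Module.End.mul_apply]
    · refine ⟨1, ?_⟩
      rw [pow_one, opU_T, opUT, if_neg h4]
      exact zero_mem _

/-- Modulo `I` every Laurent polynomial is eventually mapped to a constant. -/
lemma exists_opU_pow_sub_mem (h2 : (2 : K) ∈ I) (g : K[T;T⁻¹]) :
    ∃ (b₀ : ℕ) (y : K), ∀ b ≥ b₀,
      (θ.opU m ^ b) g - y • (1 : K[T;T⁻¹]) ∈ I • (⊤ : Submodule K K[T;T⁻¹]) := by
  induction g using LaurentPolynomial.induction_on' with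
  | add p q hp hq =>
    obtain ⟨b₁, y₁, h₁⟩ := hp
    obtain ⟨b₂, y₂, h₂⟩ := hq
    refine ⟨max b₁ b₂, y₁ + y₂, fun b hb => ?_⟩
    have := add_mem (h₁ b ((le_max_left _ _).trans hb)) (h₂ b ((le_max_right _ _).trans hb))
    rw [map_add, add_smul]
    convert this using 1
    abel
  | C_mul_T k x =>
    rw [← LaurentPolynomial.smul_eq_C_mul]
    by_cases hk : k = 0
    · subst hk
      refine ⟨0, x, fun b _ => ?_⟩
      rw [map_smul, T_zero, ← smul_sub]
      exact Submodule.smul_mem _ _ (θ.opU_pow_one_sub_mem m h2 b)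
    · obtain ⟨b₀, hb₀⟩ := θ.exists_opU_pow_T_mem m h2 _ k hk le_rfl
      refine ⟨b₀, 0, fun b hb => ?_⟩
      obtain ⟨r, rfl⟩ := Nat.exists_eq_add_of_le hb
      rw [zero_smul, sub_zero, map_smul, add_comm, pow_add, Module.End.mul_apply]
      exact Submodule.smul_mem _ _ (θ.opU_pow_mem m hb₀ r)

lemma exists_opU_pow_sub_mem_pow (h2 : (2 : K) ∈ I) (i : ℕ) {g : K[T;T⁻¹]}
    (hg : g ∈ I ^ i • (⊤ : Submodule K K[T;T⁻¹])) :
    ∃ (b₀ : ℕ) (y : K), ∀ b ≥ b₀,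
      (θ.opU m ^ b) g - y • (1 : K[T;T⁻¹]) ∈ I ^ (i + 1) • (⊤ : Submodule K K[T;T⁻¹]) := by
  refine Submodule.smul_induction_on hg (fun x hx p _ => ?_) (fun p q hp hq => ?_)
  · obtain ⟨b₀, y, h⟩ := θ.exists_opU_pow_sub_mem m h2 p
    refine ⟨b₀, x * y, fun b hb => ?_⟩
    rw [map_smul, mul_smul, ← smul_sub, pow_succ, ← smul_eq_mul, Submodule.smul_assoc]
    exact Submodule.smul_mem_smul hx (h b hb)
  · obtain ⟨b₁, y₁, h₁⟩ := hp
    obtain ⟨b₂, y₂, h₂⟩ := hq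
    refine ⟨max b₁ b₂, y₁ + y₂, fun b hb => ?_⟩
    have := add_mem (h₁ b ((le_max_left _ _).trans hb)) (h₂ b ((le_max_right _ _).trans hb))
    rw [map_add, add_smul]
    convert this using 1
    abel

lemma coeff_four_pow_mul_form (g : K[T;T⁻¹]) (b : ℕ) (n : ℤ) :
    (θ.form m g).coeff (4 ^ b * n) = (θ.form m ((θ.opU m ^ b) g)).coeff n := by
  induction b generalizing g with
  | zero => simp
  | succ b ih =>
    rw [pow_succ (θ.opU m), Module.End.mul_apply, ← ih, ← coeff_four_mul_form, pow_succ]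
    congr 1; ring

/-- The constant coefficient of `a ^ m g(t)`. -/
def constForm : K[T;T⁻¹] →ₗ[K] K where
  toFun g := (θ.form m g).coeff 0
  map_add' p q := by rw [map_add]; rfl
  map_smul' c p := by rw [map_smul]; rfl

lemma constForm_opU_pow (g : K[T;T⁻¹]) (b : ℕ) :
    θ.constForm m ((θ.opU m ^ b) g) = θ.constForm m g := by
  have := θ.coeff_four_pow_mul_form m g b 0
  rw [mul_zero] at this
  exact this.symm

lemma exists_opU_pow_mem_pow (h2 : (2 : K) ∈ I)
    (h1 : ((θ.a : LaurentSeries K) ^ m).coeff 0 = 1) {g : K[T;T⁻¹]}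
    (hg : (θ.form m g).coeff 0 = 0) (i : ℕ) :
    ∃ b, (θ.opU m ^ b) g ∈ I ^ i • (⊤ : Submodule K K[T;T⁻¹]) := by
  induction i with
  | zero => exact ⟨0, by rw [pow_zero, Ideal.one_eq_top, Submodule.top_smul]; trivial⟩
  | succ i ih =>
    obtain ⟨b, hb⟩ := ih
    obtain ⟨b₁, y, hy⟩ := θ.exists_opU_pow_sub_mem_pow m h2 i hb
    have hmem := hy b₁ le_rfl
    have hc := linearMap_mem_smul_top (θ.constForm m) hmem
    have hone : θ.constForm m 1 = 1 := by
      change ((θ.a : LaurentSeries K) ^ m * θ.ev 1).coeff 0 = 1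
      rw [map_one, mul_one, h1]
    rw [map_sub, constForm_opU_pow, constForm_opU_pow, map_smul, hone, show θ.constForm m g = 0
      from hg, zero_sub, Ideal.smul_eq_mul, Ideal.mul_top, neg_mem_iff, smul_eq_mul, mul_one] at hc
    refine ⟨b₁ + b, ?_⟩
    rw [pow_add (θ.opU m), Module.End.mul_apply]
    simpa using add_mem hmem (Submodule.smul_mem_smul hc (Submodule.mem_top (x := (1 : K[T;T⁻¹]))))

lemma exists_coeff_four_pow_mul_form_eq_zero (h2 : (2 : K) ∈ I) {j : ℕ} (hj : I ^ j = ⊥)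
    (h1 : ((θ.a : LaurentSeries K) ^ m).coeff 0 = 1) {g : K[T;T⁻¹]}
    (hg : (θ.form m g).coeff 0 = 0) :
    ∃ b : ℕ, ∀ n : ℤ, (θ.form m g).coeff (4 ^ b * n) = 0 := by
  obtain ⟨b, hb⟩ := θ.exists_opU_pow_mem_pow m h2 h1 hg j
  refine ⟨b, fun n => ?_⟩
  rw [hj, Submodule.bot_smul, Submodule.mem_bot] at hb
  rw [coeff_four_pow_mul_form, hb, map_zero, HahnSeries.coeff_zero]

/-- The unit `1 - 16T⁴`. -/
def w : K[T;T⁻¹]ˣ := θ.onePlus (-8 * T 1 ^ 4)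

lemma ev_w : θ.ev θ.w = 1 - 16 * (θ.t : LaurentSeries K) ^ 4 := by
  simp only [w, onePlus_val, map_add, map_mul, map_neg, map_pow, ev_T, map_one, map_ofNat]
  rw [_root_.zpow_one]; ring

theorem exists_coeff_four_pow_mul_eq_zero (h2 : (2 : K) ∈ I) {j : ℕ} (hj : I ^ j = ⊥)
    (h1 : ((θ.a : LaurentSeries K) ^ m).coeff 0 = 1) (F : LaurentSeries K) (e k : ℕ) (c : ℕ → K)
    (hF : F * (θ.a * (θ.a ^ 4 - 16 * θ.b ^ 4)) ^ e * θ.b ^ k =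
      ∑ i ∈ Finset.range (m + 5 * e + k + 1),
        (HahnSeries.C (c i) : LaurentSeries K) * (θ.a : LaurentSeries K) ^ (m + 5 * e + k - i) *
          (θ.b : LaurentSeries K) ^ i)
    (hF0 : F.coeff 0 = 0) : ∃ b : ℕ, ∀ n : ℤ, F.coeff (4 ^ b * n) = 0 := by
  let g : K[T;T⁻¹] := (∑ i ∈ Finset.range (m + 5 * e + k + 1), C (c i) * T 1 ^ i) *
    T (-(k : ℤ)) * ((θ.w⁻¹ ^ e : K[T;T⁻¹]ˣ) : K[T;T⁻¹])
  suffices h : F = θ.form m g by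
    rw [h] at hF0 ⊢
    exact θ.exists_coeff_four_pow_mul_form_eq_zero m h2 hj h1 hF0
  have hta := θ.t_mul_a
  have hw : θ.ev θ.w * θ.ev ((θ.w⁻¹ : K[T;T⁻¹]ˣ) : K[T;T⁻¹]) = 1 := by
    rw [← map_mul, Units.mul_inv, map_one]
  have hT : θ.ev (T (-(k : ℤ))) * (θ.t : LaurentSeries K) ^ k = 1 := by
    rw [ev_T, _root_.zpow_neg, ← Units.val_pow_eq_pow_val, ← Units.val_mul, _root_.zpow_natCast,
      inv_mul_cancel, Units.val_one]
  have hD : (θ.a : LaurentSeries K) * (θ.a ^ 4 - 16 * θ.b ^ 4) = θ.a ^ 5 * θ.ev θ.w := by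
    rw [ev_w, ← hta]; ring
  have hunit : IsUnit ((θ.a * (θ.a ^ 4 - 16 * θ.b ^ 4)) ^ e * θ.b ^ k : LaurentSeries K) := by
    rw [hD]
    exact ((θ.a.isUnit.pow 5).mul (θ.w.isUnit.map θ.ev)).pow e |>.mul (θ.b.isUnit.pow k)
  refine hunit.mul_right_cancel ?_
  rw [← mul_assoc, hF, form_apply, hD]
  have hev : θ.ev g = (∑ i ∈ Finset.range (m + 5 * e + k + 1),
      (HahnSeries.C (c i) : LaurentSeries K) * (θ.t : LaurentSeries K) ^ i) * θ.ev (T (-(k : ℤ))) *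
        θ.ev ((θ.w⁻¹ : K[T;T⁻¹]ˣ) : K[T;T⁻¹]) ^ e := by
    simp only [g, map_mul, map_sum, ev_C, map_pow, Units.val_pow_eq_pow_val]
    rw [θ.ev_T 1, _root_.zpow_one]
  have hsum : ∑ i ∈ Finset.range (m + 5 * e + k + 1),
        (HahnSeries.C (c i) : LaurentSeries K) * (θ.a : LaurentSeries K) ^ (m + 5 * e + k - i) *
          (θ.b : LaurentSeries K) ^ i =
      θ.a ^ (m + 5 * e + k) * ∑ i ∈ Finset.range (m + 5 * e + k + 1),
        (HahnSeries.C (c i) : LaurentSeries K) * (θ.t : LaurentSeries K) ^ i := by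
    rw [Finset.mul_sum]
    refine Finset.sum_congr rfl fun i hi => ?_
    rw [← hta, mul_pow, ← pow_sub_mul_pow (θ.a : LaurentSeries K)
      (show i ≤ m + 5 * e + k by simp at hi; omega)]
    ring
  rw [hev, hsum]
  set S := ∑ i ∈ Finset.range (m + 5 * e + k + 1),
    (HahnSeries.C (c i) : LaurentSeries K) * (θ.t : LaurentSeries K) ^ i
  calc (θ.a : LaurentSeries K) ^ (m + 5 * e + k) * S
      = θ.a ^ (m + 5 * e + k) * S *
          (θ.ev θ.w * θ.ev ((θ.w⁻¹ : K[T;T⁻¹]ˣ) : K[T;T⁻¹])) ^ e *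
          (θ.ev (T (-(k : ℤ))) * (θ.t : LaurentSeries K) ^ k) := by
        rw [hw, hT, one_pow, mul_one, mul_one]
    _ = _ := by rw [← hta]; ring

end ThetaPair

end FormalThetaCongruence

section ThetaNullwerte

/-- `∑ e^(2πi n² z)`. -/
def th₀ (z : ℂ) : ℂ := jacobiTheta (2 * z)

/-- `∑ e^(2πi (n + 1/2)² z)`. -/
def th₁ (z : ℂ) : ℂ := jacobiTheta (z / 2) - jacobiTheta (2 * z)

lemma _root_.HasSum.of_eq {ι : Type*} {f g : ι → ℂ} {a : ℂ} (h : HasSum g a)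
    (hfg : ∀ i, f i = g i) : HasSum f a := by
  rwa [funext hfg]

lemma hasSum_of_isCompl_range {α β γ : Type*} {f : γ → ℂ} {φ : α → γ} {ψ : β → γ}
    (hφ : φ.Injective) (hψ : ψ.Injective) (h : IsCompl (Set.range φ) (Set.range ψ)) {a b : ℂ}
    (ha : HasSum (f ∘ φ) a) (hb : HasSum (f ∘ ψ) b) : HasSum f (a + b) :=
  HasSum.add_isCompl h (hφ.hasSum_range_iff.2 ha) (hψ.hasSum_range_iff.2 hb)

lemma im_two_mul_pos {z : ℂ} (hz : 0 < z.im) : 0 < (2 * z).im := by simpa using hz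

lemma im_half_pos {z : ℂ} (hz : 0 < z.im) : 0 < (z / 2).im := by
  rw [show z / 2 = ((1 / 2 : ℝ) : ℂ) * z by push_cast; ring, im_ofReal_mul]; positivity

lemma hasSum_jacobiTheta {z : ℂ} (hz : 0 < z.im) :
    HasSum (fun n : ℤ => cexp (π * Complex.I * (n : ℂ) ^ 2 * z)) (jacobiTheta z) := by
  have := hasSum_jacobiTheta₂_term 0 hz
  rw [← jacobiTheta_eq_jacobiTheta₂] at this
  simpa [jacobiTheta₂_term] using this

lemma hasSum_th₀ {z : ℂ} (hz : 0 < z.im) :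
    HasSum (fun n : ℤ => cexp (2 * π * Complex.I * (n : ℂ) ^ 2 * z)) (th₀ z) := by
  rw [th₀]
  convert hasSum_jacobiTheta (im_two_mul_pos hz) using 3
  ring

lemma isCompl_even_odd : IsCompl (Set.range fun n : ℤ => 2 * n) (Set.range fun n : ℤ => 2 * n + 1) := by
  refine ⟨Set.disjoint_left.2 ?_, codisjoint_iff.2 ?_⟩
  · rintro _ ⟨a, rfl⟩ ⟨b, hb⟩
    simp only at hb
    omega
  · ext n
    simp only [Set.sup_eq_union, Set.top_eq_univ, Set.mem_union, Set.mem_range, Set.mem_univ, iff_true]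
    rcases Int.even_or_odd' n with ⟨k, h | h⟩
    · exact Or.inl ⟨k, h.symm⟩
    · exact Or.inr ⟨k, h.symm⟩

lemma hasSum_th₁ {z : ℂ} (hz : 0 < z.im) :
    HasSum (fun n : ℤ => cexp (2 * π * Complex.I * ((n : ℂ) + 1 / 2) ^ 2 * z)) (th₁ z) := by
  have h := hasSum_jacobiTheta (im_half_pos hz)
  have hinj : (fun n : ℤ => 2 * n + 1).Injective := fun a b hab => by simp only at hab; omega
  obtain ⟨S, hS⟩ := h.summable.comp_injective hinj
  have he : HasSum ((fun n : ℤ => cexp (π * Complex.I * (n : ℂ) ^ 2 * (z / 2))) ∘ fun n : ℤ => 2 * n)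
      (th₀ z) := by
    convert hasSum_th₀ hz using 3
    simp only [Function.comp_apply]
    congr 1
    push_cast
    ring
  have := hasSum_of_isCompl_range (fun a b hab => by simpa using hab) hinj
    isCompl_even_odd he hS
  have hSval : S = th₁ z := by rw [th₁, h.unique this, th₀]; ring
  rw [← hSval]
  refine hS.of_eq fun n => ?_
  simp only [Function.comp_apply]
  congr 1
  push_cast
  ring

lemma th₀_add_th₁ (z : ℂ) : th₀ z + th₁ z = jacobiTheta (z / 2) := by rw [th₀, th₁]; ring

lemma th₀_add_one (z : ℂ) : th₀ (z + 1) = th₀ z := by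
  rw [th₀, th₀, show 2 * (z + 1) = 2 + 2 * z by ring, jacobiTheta_two_add]

lemma th₁_add_one {z : ℂ} (hz : 0 < z.im) : th₁ (z + 1) = Complex.I * th₁ z := by
  have hz' : 0 < (z + 1).im := by simpa using hz
  refine (hasSum_th₁ hz').unique ?_
  refine ((hasSum_th₁ hz).mul_left Complex.I).of_eq fun n => ?_
  have : cexp (π / 2 * Complex.I) = Complex.I := by
    rw [show (π : ℂ) / 2 * Complex.I = ((π / 2 : ℝ) : ℂ) * Complex.I by push_cast; ring, exp_mul_I]
    rw [← ofReal_cos, ← ofReal_sin]; simp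
  rw [show (2 * π * Complex.I * ((n : ℂ) + 1 / 2) ^ 2 * (z + 1) : ℂ) =
    π / 2 * Complex.I + 2 * π * Complex.I * ((n : ℂ) + 1 / 2) ^ 2 * z + (n ^ 2 + n : ℤ) * (2 * π * Complex.I) by
      push_cast; ring, Complex.exp_add, exp_int_mul_two_pi_mul_I, Complex.exp_add, this, mul_one]

/-- The automorphy factor of the inversion. -/
def invFactor (z : ℂ) : ℂ := (-Complex.I * (z / 2)) ^ (1 / 2 : ℂ)

lemma invFactor_ne_zero {z : ℂ} (hz : z ≠ 0) : invFactor z ≠ 0 := by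
  rw [invFactor, Complex.cpow_ne_zero_iff_of_exponent_ne_zero (by norm_num)]
  simp [hz]

lemma invFactor_sq (z : ℂ) : invFactor z ^ 2 = -Complex.I * (z / 2) := by
  rw [invFactor, show (1 / 2 : ℂ) = ((2 : ℕ) : ℂ)⁻¹ by simp]
  exact Complex.cpow_nat_inv_pow _ two_ne_zero

lemma norm_invFactor_pow (z : ℂ) : ‖invFactor z‖ ^ 4 = ‖z‖ ^ 2 / 4 := by
  rw [show 4 = 2 * 2 from rfl, pow_mul, ← norm_pow, invFactor_sq]
  simp [div_pow]; norm_num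

lemma jacobiTheta_neg_inv {z : ℂ} (hz : z ≠ 0) :
    jacobiTheta (-1 / z) = (-Complex.I * z) ^ (1 / 2 : ℂ) * jacobiTheta z := by
  rw [jacobiTheta_eq_jacobiTheta₂ z, jacobiTheta₂_functional_equation, jacobiTheta_eq_jacobiTheta₂]
  have : (-Complex.I * z) ^ (1 / 2 : ℂ) ≠ 0 := by
    rw [Complex.cpow_ne_zero_iff_of_exponent_ne_zero (by norm_num)]; simp [hz]
  rw [zero_div, zero_pow two_ne_zero, mul_zero, zero_div, Complex.exp_zero, mul_one, ← mul_assoc,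
    mul_one_div_cancel this, one_mul]

lemma th₀_neg_inv {z : ℂ} (hz : z ≠ 0) : th₀ (-z)⁻¹ = invFactor z * (th₀ z + th₁ z) := by
  rw [th₀_add_th₁, invFactor, ← jacobiTheta_neg_inv (div_ne_zero hz two_ne_zero), th₀]
  congr 1; field_simp

lemma th₁_neg_inv {z : ℂ} (hz : z ≠ 0) : th₁ (-z)⁻¹ = invFactor z * (th₀ z - th₁ z) := by
  have h4 : (-Complex.I * (2 * z)) ^ (1 / 2 : ℂ) = 2 * invFactor z := by
    have hne : -Complex.I * (z / 2) ≠ 0 := by simp [hz]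
    have h4' : Complex.log (4 : ℝ) = 2 * Complex.log 2 := by
      rw [show (4 : ℝ) = 2 ^ 2 by norm_num, ← Complex.ofReal_log (by norm_num), Real.log_pow]
      push_cast [Complex.ofReal_log]
      rw [Complex.ofReal_log (by norm_num)]; push_cast; rfl
    rw [invFactor, show -Complex.I * (2 * z) = ((4 : ℝ) : ℂ) * (-Complex.I * (z / 2)) by push_cast; ring,
      cpow_def_of_ne_zero (mul_ne_zero (by norm_num) hne), cpow_def_of_ne_zero hne,
      Complex.log_ofReal_mul (by norm_num) hne, Complex.ofReal_log (by norm_num), h4', add_mul,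
      Complex.exp_add]
    congr 1
    rw [show 2 * Complex.log 2 * (1 / 2) = Complex.log 2 by ring, Complex.exp_log two_ne_zero]
  have h0 := th₀_neg_inv hz
  have : th₁ (-z)⁻¹ = jacobiTheta (-1 / (2 * z)) - th₀ (-z)⁻¹ := by
    rw [th₁, th₀]; congr 2; field_simp
  rw [this, h0, jacobiTheta_neg_inv (mul_ne_zero two_ne_zero hz), h4, th₀]
  ring

/-- `(u, v) ↦ (u + v, u - v)`. -/
def sumDiff (p : ℤ × ℤ) : ℤ × ℤ := (p.1 + p.2, p.1 - p.2)

/-- `(u, v) ↦ (u + v + 1, u - v)`. -/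
def sumDiffSucc (p : ℤ × ℤ) : ℤ × ℤ := (p.1 + p.2 + 1, p.1 - p.2)

lemma sumDiff_injective : sumDiff.Injective := by
  rintro ⟨a, b⟩ ⟨c, d⟩ h
  simp only [sumDiff, Prod.mk.injEq] at h ⊢
  omega

lemma sumDiffSucc_injective : sumDiffSucc.Injective := by
  rintro ⟨a, b⟩ ⟨c, d⟩ h
  simp only [sumDiffSucc, Prod.mk.injEq] at h ⊢
  omega

lemma isCompl_range_sumDiff : IsCompl (Set.range sumDiff) (Set.range sumDiffSucc) := by
  refine ⟨Set.disjoint_left.2 ?_, codisjoint_iff.2 ?_⟩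
  · rintro _ ⟨⟨a, b⟩, rfl⟩ ⟨⟨c, d⟩, h⟩
    simp only [sumDiffSucc, sumDiff, Prod.mk.injEq] at h
    omega
  · ext ⟨x, y⟩
    simp only [Set.sup_eq_union, Set.top_eq_univ, Set.mem_union, Set.mem_range, Set.mem_univ, iff_true, sumDiff, sumDiffSucc,
      Prod.exists, Prod.mk.injEq]
    rcases Int.even_or_odd' (x + y) with ⟨k, h | h⟩
    · exact Or.inl ⟨k, x - k, by omega, by omega⟩
    · exact Or.inr ⟨k, x - k - 1, by omega, by omega⟩

lemma _root_.HasSum.mul_complex {ι κ : Type*} {f : ι → ℂ} {g : κ → ℂ} {a b : ℂ} (hf : HasSum f a)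
    (hg : HasSum g b) : HasSum (fun x : ι × κ => f x.1 * g x.2) (a * b) :=
  hf.mul hg (summable_mul_of_summable_norm hf.summable.norm hg.summable.norm)

lemma th₀_sq {z : ℂ} (hz : 0 < z.im) : th₀ z ^ 2 = th₀ (2 * z) ^ 2 + th₁ (2 * z) ^ 2 := by
  have hz' := im_two_mul_pos hz
  rw [sq, sq, sq]
  refine ((hasSum_th₀ hz).mul_complex (hasSum_th₀ hz)).unique
    (hasSum_of_isCompl_range sumDiff_injective sumDiffSucc_injective isCompl_range_sumDiff ?_ ?_)
  · convert (hasSum_th₀ hz').mul_complex (hasSum_th₀ hz') using 2 with p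
    simp only [Function.comp_apply, sumDiff, ← Complex.exp_add]
    congr 1; push_cast; ring
  · convert (hasSum_th₁ hz').mul_complex (hasSum_th₁ hz') using 2 with p
    simp only [Function.comp_apply, sumDiffSucc, ← Complex.exp_add]
    congr 1; push_cast; ring

lemma th₁_sq {z : ℂ} (hz : 0 < z.im) : th₁ z ^ 2 = 2 * th₀ (2 * z) * th₁ (2 * z) := by
  have hz' := im_two_mul_pos hz
  have hshift : HasSum (fun n : ℤ => cexp (2 * π * Complex.I * ((n : ℂ) + 1) ^ 2 * (2 * z)))
      (th₀ (2 * z)) := by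
    have := (Equiv.addRight (1 : ℤ)).hasSum_iff.2 (hasSum_th₀ hz')
    convert this using 3 with n
    simp
  rw [sq, show 2 * th₀ (2 * z) * th₁ (2 * z) = th₁ (2 * z) * th₀ (2 * z) +
    th₀ (2 * z) * th₁ (2 * z) by ring]
  refine ((hasSum_th₁ hz).mul_complex (hasSum_th₁ hz)).unique
    (hasSum_of_isCompl_range sumDiff_injective sumDiffSucc_injective isCompl_range_sumDiff ?_ ?_)
  · convert (hasSum_th₁ hz').mul_complex (hasSum_th₀ hz') using 2 with p
    simp only [Function.comp_apply, sumDiff, ← Complex.exp_add]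
    congr 1; push_cast; ring
  · convert hshift.mul_complex (hasSum_th₁ hz') using 2 with p
    simp only [Function.comp_apply, sumDiffSucc, ← Complex.exp_add]
    congr 1; push_cast; ring

end ThetaNullwerte

section ThetaAction

lemma norm_jacobiTheta_sub_one_le_of_le {z : ℂ} {x : ℝ} (hx : 0 < x) (hz : x ≤ z.im) :
    ‖jacobiTheta z - 1‖ ≤ 2 / (1 - rexp (-π * x)) * rexp (-π * z.im) := by
  have h1 : rexp (-π * x) < 1 := by
    rw [Real.exp_lt_one_iff]; nlinarith [Real.pi_pos]
  have h2 : rexp (-π * z.im) ≤ rexp (-π * x) := by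
    rw [Real.exp_le_exp]; nlinarith [Real.pi_pos]
  refine (norm_jacobiTheta_sub_one_le (hx.trans_le hz)).trans ?_
  have : 0 < 1 - rexp (-π * x) := by linarith
  gcongr

lemma im_half (z : ℂ) : (z / 2).im = z.im / 2 := by
  rw [show z / 2 = ((1 / 2 : ℝ) : ℂ) * z by push_cast; ring, im_ofReal_mul]; ring

lemma im_two_mul (z : ℂ) : (2 * z).im = 2 * z.im := by
  rw [show 2 * z = ((2 : ℝ) : ℂ) * z by push_cast; ring, im_ofReal_mul]

lemma norm_th₀_sub_one_le {z : ℂ} {x : ℝ} (hx : 0 < x) (hz : x ≤ z.im) :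
    ‖th₀ z - 1‖ ≤ 2 / (1 - rexp (-π * (2 * x))) * rexp (-π * (2 * z.im)) := by
  have := norm_jacobiTheta_sub_one_le_of_le (z := 2 * z) (x := 2 * x) (by linarith)
    (by rw [im_two_mul]; linarith)
  rwa [im_two_mul] at this

lemma norm_th₁_le {z : ℂ} {x : ℝ} (hx : 0 < x) (hz : x ≤ z.im) :
    ‖th₁ z‖ ≤ 2 / (1 - rexp (-π * (x / 2))) * rexp (-π * (z.im / 2)) +
      2 / (1 - rexp (-π * (2 * x))) * rexp (-π * (2 * z.im)) := by
  have h1 := norm_jacobiTheta_sub_one_le_of_le (z := z / 2) (x := x / 2) (by linarith)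
    (by rw [im_half]; linarith)
  have h2 := norm_th₀_sub_one_le hx hz
  rw [im_half] at h1
  calc ‖th₁ z‖ = ‖(jacobiTheta (z / 2) - 1) - (th₀ z - 1)‖ := by rw [th₁, th₀]; congr 1; ring
    _ ≤ _ := (norm_sub_le _ _).trans (add_le_add h1 h2)

lemma norm_th₁_lt_norm_th₀ {z : ℂ} (hz : 17 / 20 ≤ z.im) : ‖th₁ z‖ < ‖th₀ z‖ := by
  have h0 := norm_th₀_sub_one_le (x := 17 / 20) (by norm_num) hz
  have h1 := norm_th₁_le (x := 17 / 20) (by norm_num) hz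
  have hexp (t : ℝ) (ht : 17 / 20 ≤ t) : rexp (-π * (t / 2)) ≤ 3 / 10 := by
    have h : (10 / 3 : ℝ) ≤ rexp (π * (t / 2)) := by
      calc (10 / 3 : ℝ) ≤ 2.7182818283 * (1 / 4 + 1) := by norm_num
        _ ≤ rexp 1 * rexp (1 / 4) :=
          mul_le_mul Real.exp_one_gt_d9.le (Real.add_one_le_exp _) (by norm_num) (Real.exp_pos _).le
        _ ≤ rexp (π * (t / 2)) := by
          rw [← Real.exp_add, Real.exp_le_exp]
          nlinarith [Real.pi_gt_three]
    rw [neg_mul, Real.exp_neg]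
    exact inv_le_of_inv_le₀ (by norm_num) (by norm_num; linarith)
  have hpow (t : ℝ) : rexp (-π * (2 * t)) = rexp (-π * (t / 2)) ^ 4 := by
    rw [← Real.exp_nat_mul]; congr 1; push_cast; ring
  rw [hpow, hpow] at h0 h1
  have ha := hexp _ (le_refl (17 / 20))
  have hb := hexp _ hz
  set a := rexp (-π * (17 / 20 / 2))
  set b := rexp (-π * (z.im / 2))
  have ha0 : 0 < a := Real.exp_pos _
  have hb0 : 0 < b := Real.exp_pos _
  have ha4 : a ^ 4 ≤ (3 / 10) ^ 4 := by gcongr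
  have hb4 : b ^ 4 ≤ (3 / 10) ^ 4 := by gcongr
  have e1 : 2 / (1 - a) * b ≤ 2 / (1 - 3 / 10) * (3 / 10) := by gcongr
  have e2 : 2 / (1 - a ^ 4) * b ^ 4 ≤ 2 / (1 - (3 / 10) ^ 4) * (3 / 10) ^ 4 := by gcongr
  have h3 : 1 ≤ ‖th₀ z‖ + ‖th₀ z - 1‖ := by
    have := norm_sub_le (th₀ z) (th₀ z - 1)
    simpa using this
  norm_num at e1 e2
  linarith

lemma hasSum_nat_th₁ {z : ℂ} (hz : 0 < z.im) :
    HasSum (fun n : ℕ => cexp (2 * π * Complex.I * ((n : ℂ) + 1 / 2) ^ 2 * z)) (th₁ z / 2) := by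
  refine ((hasSum_th₁ hz).nat_add_neg_add_one.div_const 2).of_eq fun n => ?_
  rw [show 2 * π * Complex.I * (((-((n : ℤ) + 1) : ℤ) : ℂ) + 1 / 2) ^ 2 * z =
    2 * π * Complex.I * (((n : ℤ) : ℂ) + 1 / 2) ^ 2 * z by push_cast; ring]
  push_cast
  ring

lemma ne_zero_of_hasSum_geometric {f : ℕ → ℂ} {a : ℂ} (hf : HasSum f a) {r : ℝ} (hr0 : 0 ≤ r)
    (hr : r < 1 / 2) (h0 : f 0 ≠ 0) (hle : ∀ n, ‖f (n + 1)‖ ≤ ‖f 0‖ * r ^ (n + 1)) : a ≠ 0 := by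
  intro ha
  have h1 := (hasSum_nat_add_iff' 1).2 hf
  rw [ha, Finset.sum_range_one, zero_sub] at h1
  have hg : HasSum (fun n : ℕ => ‖f 0‖ * r ^ (n + 1)) (‖f 0‖ * (r * (1 - r)⁻¹)) := by
    simp_rw [pow_succ']
    exact ((hasSum_geometric_of_lt_one hr0 (by linarith)).mul_left r).mul_left _
  have := h1.norm_le_of_bounded hg hle
  rw [norm_neg] at this
  have hpos : 0 < ‖f 0‖ := norm_pos_iff.2 h0
  have : 1 ≤ r * (1 - r)⁻¹ := by
    by_contra! h
    nlinarith
  rw [← div_eq_mul_inv, le_div_iff₀ (by linarith)] at this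
  linarith

lemma th₁_ne_zero_of_le {z : ℂ} (hz : 17 / 20 ≤ z.im) : th₁ z ≠ 0 := by
  have hz0 : 0 < z.im := by linarith
  suffices th₁ z / 2 ≠ 0 from fun h => this (by rw [h, zero_div])
  refine ne_zero_of_hasSum_geometric (hasSum_nat_th₁ hz0) (r := rexp (-1))
    (Real.exp_pos _).le ?_ (Complex.exp_ne_zero _) fun n => ?_
  · rw [Real.exp_neg]
    exact inv_lt_of_inv_lt₀ (by norm_num) (by norm_num; linarith [Real.exp_one_gt_d9])
  · have hre (x : ℝ) : (2 * π * Complex.I * ((x : ℂ) + 1 / 2) ^ 2 * z).re =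
        -(2 * π * (x + 1 / 2) ^ 2 * z.im) := by
      rw [show 2 * π * Complex.I * ((x : ℂ) + 1 / 2) ^ 2 * z =
        ((2 * π * (x + 1 / 2) ^ 2 : ℝ) : ℂ) * (Complex.I * z) by push_cast; ring, re_ofReal_mul,
        I_mul_re]
      ring
    have hre' (k : ℕ) : (2 * π * Complex.I * ((k : ℂ) + 1 / 2) ^ 2 * z).re =
        -(2 * π * (k + 1 / 2) ^ 2 * z.im) := by
      simpa using hre k
    rw [Complex.norm_exp, Complex.norm_exp, hre', hre', ← Real.exp_nat_mul, ← Real.exp_add,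
      Real.exp_le_exp]
    push_cast
    have hp : 1 ≤ π * z.im := by nlinarith [Real.pi_gt_three]
    have hn : (0 : ℝ) ≤ n := n.cast_nonneg
    nlinarith [mul_nonneg (mul_nonneg hn hn) (by linarith : (0 : ℝ) ≤ π * z.im - 1),
      mul_nonneg hn (by linarith : (0 : ℝ) ≤ π * z.im - 1)]

/-- The coefficient of `th₁` in the linear form attached to a vector with coordinate product `n`. -/
def omegaCoeff : ZMod 4 → ℂ := ![-1, -Complex.I, 1, Complex.I]

/-- Linear forms in `th₀, th₁` indexed by vectors modulo `4`. -/
def thetaForm (v : ZMod 4 × ZMod 4) (z : ℂ) : ℂ :=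
  if v.1 = 0 then th₁ z else if v.1 = 2 then th₀ z else th₀ z + omegaCoeff (v.1 * v.2) * th₁ z

/-- The right action of `SL₂(ℤ)` on row vectors modulo `4`. -/
def actMod4 (v : ZMod 4 × ZMod 4) (γ : SL(2, ℤ)) : ZMod 4 × ZMod 4 :=
  (v.1 * (γ 0 0 : ℤ) + v.2 * (γ 1 0 : ℤ), v.1 * (γ 0 1 : ℤ) + v.2 * (γ 1 1 : ℤ))

lemma actMod4_mul (v : ZMod 4 × ZMod 4) (γ δ : SL(2, ℤ)) :
    actMod4 v (γ * δ) = actMod4 (actMod4 v γ) δ := by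
  have h (i k : Fin 2) : (γ * δ) i k = γ i 0 * δ 0 k + γ i 1 * δ 1 k := by
    change (γ.1 * δ.1) i k = _
    rw [Matrix.mul_apply, Fin.sum_univ_two]
  simp only [actMod4, h, Prod.mk.injEq]
  constructor <;> (push_cast; ring)

lemma actMod4_one (v : ZMod 4 × ZMod 4) : actMod4 v 1 = v := by
  simp [actMod4]

/-- A vector modulo `4` which is nonzero modulo `2`. -/
def IsPrimMod4 (v : ZMod 4 × ZMod 4) : Prop := ¬ (2 * v.1 = 0 ∧ 2 * v.2 = 0)

lemma IsPrimMod4.act {v : ZMod 4 × ZMod 4} (hv : IsPrimMod4 v) (γ : SL(2, ℤ)) :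
    IsPrimMod4 (actMod4 v γ) := by
  rintro ⟨h1, h2⟩
  have h : actMod4 (actMod4 v γ) γ⁻¹ = v := by
    rw [← actMod4_mul, mul_inv_cancel, actMod4_one]
  refine hv ⟨?_, ?_⟩
  · rw [← h, actMod4]
    linear_combination ((γ⁻¹ 0 0 : ℤ) : ZMod 4) * h1 + ((γ⁻¹ 1 0 : ℤ) : ZMod 4) * h2
  · rw [← h, actMod4]
    linear_combination ((γ⁻¹ 0 1 : ℤ) : ZMod 4) * h1 + ((γ⁻¹ 1 1 : ℤ) : ZMod 4) * h2

/-- `γ` permutes the linear forms in `th₀, th₁` up to scalars and a weight `1/2` factor. -/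
def PermutesThetaForms (γ : SL(2, ℤ)) : Prop :=
  ∃ j : ℍ → ℂ, (∀ z, j z ≠ 0) ∧ (∃ κ : ℝ, 0 < κ ∧ ∀ z, ‖j z‖ ^ 4 * (γ • z).im = κ * z.im) ∧
    ∀ v, IsPrimMod4 v → ∃ c : ℂ, c ≠ 0 ∧
      ∀ z : ℍ, thetaForm v ↑(γ • z) = c * j z * thetaForm (actMod4 v γ) z

lemma PermutesThetaForms.one : PermutesThetaForms 1 :=
  ⟨fun _ => 1, fun _ => one_ne_zero, ⟨1, one_pos, fun z => by simp⟩,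
    fun v _ => ⟨1, one_ne_zero, fun z => by simp [actMod4_one]⟩⟩

lemma PermutesThetaForms.mul {γ δ : SL(2, ℤ)} (hγ : PermutesThetaForms γ)
    (hδ : PermutesThetaForms δ) : PermutesThetaForms (γ * δ) := by
  obtain ⟨j, hj, ⟨κ, hκ, hjκ⟩, h⟩ := hγ
  obtain ⟨j', hj', ⟨κ', hκ', hjκ'⟩, h'⟩ := hδ
  refine ⟨fun z => j (δ • z) * j' z, fun z => mul_ne_zero (hj _) (hj' _),
    ⟨κ * κ', mul_pos hκ hκ', fun z => ?_⟩, fun v hv => ?_⟩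
  · rw [norm_mul, mul_pow, mul_smul]
    linear_combination ‖j' z‖ ^ 4 * hjκ (δ • z) + κ * hjκ' z
  · obtain ⟨c, hc, h⟩ := h v hv
    obtain ⟨c', hc', h'⟩ := h' _ (hv.act γ)
    refine ⟨c * c', mul_ne_zero hc hc', fun z => ?_⟩
    rw [mul_smul, h, h', actMod4_mul]
    ring

lemma PermutesThetaForms.inv {γ : SL(2, ℤ)} (hγ : PermutesThetaForms γ) :
    PermutesThetaForms γ⁻¹ := by
  obtain ⟨j, hj, ⟨κ, hκ, hjκ⟩, h⟩ := hγ
  refine ⟨fun z => (j (γ⁻¹ • z))⁻¹, fun z => inv_ne_zero (hj _),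
    ⟨κ⁻¹, inv_pos.2 hκ, fun z => ?_⟩, fun v hv => ?_⟩
  · have := hjκ (γ⁻¹ • z)
    rw [smul_inv_smul] at this
    have hn : ‖j (γ⁻¹ • z)‖ ≠ 0 := norm_ne_zero_iff.2 (hj _)
    rw [norm_inv]
    field_simp
    linear_combination -this
  · obtain ⟨c, hc, h⟩ := h _ (hv.act γ⁻¹)
    refine ⟨c⁻¹, inv_ne_zero hc, fun z => ?_⟩
    have := h (γ⁻¹ • z)
    rw [smul_inv_smul, ← actMod4_mul, inv_mul_cancel, actMod4_one] at this
    rw [this]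
    have := hj (γ⁻¹ • z)
    field_simp

lemma omegaCoeff_add_one (n : ZMod 4) : omegaCoeff (1 + n) = Complex.I * omegaCoeff n := by
  have : ∀ n : ZMod 4, n = 0 ∨ n = 1 ∨ n = 2 ∨ n = 3 := by decide
  rcases this n with rfl | rfl | rfl | rfl
  · change -Complex.I = Complex.I * -1; ring
  · change (1 : ℂ) = Complex.I * -Complex.I; rw [mul_neg, Complex.I_mul_I]; ring
  · change Complex.I = Complex.I * 1; ring
  · change (-1 : ℂ) = Complex.I * Complex.I; rw [Complex.I_mul_I]

lemma permutesThetaForms_T : PermutesThetaForms ModularGroup.T := by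
  refine ⟨fun _ => 1, fun _ => one_ne_zero, ⟨1, one_pos, fun z => ?_⟩, fun v _ => ?_⟩
  · rw [modular_T_smul, vadd_im, norm_one, one_pow]
  have hT (z : ℍ) : ((ModularGroup.T • z : ℍ) : ℂ) = z + 1 := by
    rw [modular_T_smul, coe_vadd]; push_cast; ring
  have hact : actMod4 v ModularGroup.T = (v.1, v.1 + v.2) := by
    simp [actMod4, ModularGroup.T]
  rw [hact]
  by_cases h0 : v.1 = 0
  · exact ⟨Complex.I, Complex.I_ne_zero, fun z => by
      rw [hT, thetaForm, thetaForm, if_pos h0, if_pos h0, th₁_add_one z.im_pos, mul_one]⟩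
  refine ⟨1, one_ne_zero, fun z => ?_⟩
  by_cases h2 : v.1 = 2
  · rw [hT, thetaForm, thetaForm, if_neg h0, if_neg h0, if_pos h2, if_pos h2, th₀_add_one]
    ring
  · have hsq : ∀ x : ZMod 4, x ≠ 0 → x ≠ 2 → x * x = 1 := by decide
    rw [hT, thetaForm, thetaForm, if_neg h0, if_neg h0, if_neg h2, if_neg h2, th₀_add_one,
      th₁_add_one z.im_pos, show v.1 * (v.1 + v.2) = 1 + v.1 * v.2 by rw [mul_add, hsq _ h0 h2],
      omegaCoeff_add_one]
    ring

lemma permutesThetaForms_S : PermutesThetaForms ModularGroup.S := by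
  have hS (z : ℍ) : ((ModularGroup.S • z : ℍ) : ℂ) = (-(z : ℂ))⁻¹ := by
    rw [modular_S_smul]
  refine ⟨fun z => invFactor z, fun z => invFactor_ne_zero z.ne_zero, ⟨1 / 4, by norm_num,
    fun z => ?_⟩, fun v hv => ?_⟩
  · rw [norm_invFactor_pow, ← UpperHalfPlane.coe_im, hS, inv_im, neg_im, normSq_neg,
      Complex.normSq_eq_norm_sq]
    have : ‖(z : ℂ)‖ ≠ 0 := norm_ne_zero_iff.2 z.ne_zero
    field_simp
    simp
  have hact : actMod4 v ModularGroup.S = (v.2, -v.1) := by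
    simp [actMod4, ModularGroup.S]
  rw [hact]
  simp_rw [hS]
  obtain ⟨x, y⟩ := v
  simp only
  have h4 : ∀ n : ZMod 4, n = 0 ∨ n = 1 ∨ n = 2 ∨ n = 3 := by decide
  have o0 : omegaCoeff 0 = -1 := rfl
  have o1 : omegaCoeff 1 = -Complex.I := rfl
  have o2 : omegaCoeff 2 = 1 := rfl
  have o3 : omegaCoeff 3 = Complex.I := rfl
  have e0 := fun z : ℍ => th₀_neg_inv z.ne_zero
  have e1 := fun z : ℍ => th₁_neg_inv z.ne_zero
  have hone (u : ZMod 4) (hu : u ≠ 0) (hu2 : u ≠ 2) (w : ZMod 4) (z : ℂ) :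
      thetaForm (u, w) z = th₀ z + omegaCoeff (u * w) * th₁ z := by
    rw [thetaForm, if_neg hu, if_neg hu2]
  have hzero (w : ZMod 4) (z : ℂ) : thetaForm (0, w) z = th₁ z := by rw [thetaForm, if_pos rfl]
  have htwo (w : ZMod 4) (z : ℂ) : thetaForm (2, w) z = th₀ z := by
    rw [thetaForm, if_neg (show (2 : ZMod 4) ≠ 0 by decide), if_pos rfl]
  by_cases hx0 : x = 0
  · subst hx0
    have : ∀ y : ZMod 4, ¬ (2 * (0 : ZMod 4) = 0 ∧ 2 * y = 0) → y ≠ 0 ∧ y ≠ 2 := by decide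
    obtain ⟨hy0, hy2⟩ := this y hv
    refine ⟨1, one_ne_zero, fun z => ?_⟩
    rw [hzero, hone _ hy0 hy2, e1, neg_zero, mul_zero, o0]; ring
  by_cases hx2 : x = 2
  · subst hx2
    have : ∀ y : ZMod 4, ¬ (2 * (2 : ZMod 4) = 0 ∧ 2 * y = 0) → y ≠ 0 ∧ y ≠ 2 ∧ y * -2 = 2 := by
      decide
    obtain ⟨hy0, hy2, hyy⟩ := this y hv
    refine ⟨1, one_ne_zero, fun z => ?_⟩
    rw [htwo, hone _ hy0 hy2, e0, hyy, o2]; ring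
  by_cases hy0 : y = 0
  · subst hy0
    refine ⟨2, two_ne_zero, fun z => ?_⟩
    rw [hzero, hone _ hx0 hx2, e0, e1, mul_zero, o0]; ring
  by_cases hy2 : y = 2
  · subst hy2
    have : ∀ x : ZMod 4, x ≠ 0 → x ≠ 2 → x * 2 = 2 := by decide
    refine ⟨2, two_ne_zero, fun z => ?_⟩
    rw [htwo, hone _ hx0 hx2, e0, e1, this x hx0 hx2, o2]; ring
  have key : ∀ x y : ZMod 4, x ≠ 0 → x ≠ 2 → y ≠ 0 → y ≠ 2 →
      (x * y = 1 ∧ y * -x = 3) ∨ (x * y = 3 ∧ y * -x = 1) := by decide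
  rcases key x y hx0 hx2 hy0 hy2 with ⟨h, h'⟩ | ⟨h, h'⟩
  · refine ⟨1 - Complex.I, fun h => ?_, fun z => ?_⟩
    · simpa using congrArg Complex.re h
    · rw [hone _ hx0 hx2, hone _ hy0 hy2, h, h', o1, o3, e0, e1]
      linear_combination invFactor z * th₁ z * Complex.I_sq
  · refine ⟨1 + Complex.I, fun h => ?_, fun z => ?_⟩
    · simpa using congrArg Complex.re h
    · rw [hone _ hx0 hx2, hone _ hy0 hy2, h, h', o1, o3, e0, e1]
      linear_combination invFactor z * th₁ z * Complex.I_sq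

theorem permutesThetaForms (γ : SL(2, ℤ)) : PermutesThetaForms γ := by
  have hγ : γ ∈ Subgroup.closure {ModularGroup.S, ModularGroup.T} := by
    rw [SpecialLinearGroup.SL2Z_generators]; trivial
  induction hγ using Subgroup.closure_induction with
  | mem x hx =>
    rcases hx with rfl | rfl
    · exact permutesThetaForms_S
    · exact permutesThetaForms_T
  | one => exact .one
  | mul x y _ _ hx hy => exact hx.mul hy
  | inv x _ hx => exact hx.inv

theorem thetaForm_ne_zero {v : ZMod 4 × ZMod 4} (hv : IsPrimMod4 v) (z : ℍ) :
    thetaForm v z ≠ 0 := by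
  obtain ⟨g, hg⟩ := ModularGroup.exists_smul_mem_fd z
  have him : 17 / 20 ≤ (g • z : ℍ).im := by
    have := ModularGroup.three_le_four_mul_im_sq_of_mem_fd hg
    nlinarith [(g • z : ℍ).im_pos]
  obtain ⟨j, hj, -, h⟩ := permutesThetaForms g
  obtain ⟨c, hc, h⟩ := h _ (hv.act g⁻¹)
  intro hz
  have h0 := h z
  rw [← actMod4_mul, inv_mul_cancel, actMod4_one, hz, mul_zero] at h0
  have h01 := norm_th₁_lt_norm_th₀ (z := (g • z : ℍ)) him
  rw [thetaForm] at h0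
  split_ifs at h0
  · exact th₁_ne_zero_of_le him h0
  · rw [h0, norm_zero] at h01; linarith [norm_nonneg (th₁ (g • z : ℍ))]
  · rw [add_eq_zero_iff_eq_neg] at h0
    rw [h0, norm_neg, norm_mul] at h01
    have hnorm : ∀ n, ‖omegaCoeff n‖ = 1 := by
      have : ∀ n : ZMod 4, n = 0 ∨ n = 1 ∨ n = 2 ∨ n = 3 := by decide
      intro n
      rcases this n with rfl | rfl | rfl | rfl <;> simp [omegaCoeff]
    rw [hnorm, one_mul] at h01
    exact lt_irrefl _ h01

end ThetaAction

section Decomposition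

lemma coe_smul_eq (σ : SL(2, ℤ)) (τ : ℍ) :
    ((σ • τ : ℍ) : ℂ) = ((σ 0 0 : ℤ) * τ + (σ 0 1 : ℤ)) / ((σ 1 0 : ℤ) * τ + (σ 1 1 : ℤ)) := by
  rw [coe_specialLinearGroup_apply]
  simp

lemma denomC_ne_zero (σ : SL(2, ℤ)) (τ : ℍ) : denomC σ τ ≠ 0 := by
  have := denom_ne_zero (σ : GL (Fin 2) ℝ) τ
  simpa [denom, denomC] using this

lemma im_smul_mul_norm_denomC (σ : SL(2, ℤ)) (τ : ℍ) :
    (σ • τ).im * ‖denomC σ τ‖ ^ 2 = τ.im := by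
  have h : ‖denomC σ τ‖ ≠ 0 := norm_ne_zero_iff.2 (denomC_ne_zero σ τ)
  have := ModularGroup.im_smul_eq_div_normSq σ τ
  rw [Complex.normSq_eq_norm_sq] at this
  have hd : denom (σ : GL (Fin 2) ℝ) τ = denomC σ τ := by simp [denom, denomC]
  rw [this, hd]
  field_simp

lemma det_eq_one (σ : SL(2, ℤ)) : σ 0 0 * σ 1 1 - σ 0 1 * σ 1 0 = 1 := by
  have := σ.2
  rwa [Matrix.det_fin_two] at this

lemma four_mul_im_pos (τ : ℍ) : 0 < (4 * (τ : ℂ)).im := by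
  have : (4 * (τ : ℂ)).im = 4 * τ.im := by
    rw [show 4 * (τ : ℂ) = ((4 : ℝ) : ℂ) * τ by push_cast; ring, im_ofReal_mul]; rfl
  rw [this]; linarith [τ.im_pos]

/-- The point `4τ` of the upper half plane. -/
def quad (τ : ℍ) : ℍ := ⟨4 * τ, four_mul_im_pos τ⟩

@[simp] lemma coe_quad (τ : ℍ) : (quad τ : ℂ) = 4 * τ := rfl

lemma im_quad (τ : ℍ) : (quad τ).im = 4 * τ.im := by
  rw [← UpperHalfPlane.coe_im, coe_quad,
    show 4 * (τ : ℂ) = ((4 : ℝ) : ℂ) * τ by push_cast; ring, im_ofReal_mul]; rfl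

lemma im_affine (x w : ℕ) (y : ℤ) (τ : ℂ) :
    (((x : ℂ) * τ + y) / w).im = (x : ℝ) / w * τ.im := by
  rw [show ((x : ℂ) * τ + y) / w = ((x / w : ℝ) : ℂ) * τ + ((y / w : ℝ) : ℂ) by push_cast; ring,
    add_im, im_ofReal_mul, ofReal_im, add_zero]

lemma quad_smul_eq (σ σ' : SL(2, ℤ)) (ζ : ℍ) (τ : ℍ) (x w : ℕ) (y : ℤ) (hw : w ≠ 0)
    (hζ : (ζ : ℂ) = ((x : ℂ) * τ + y) / w)
    (h00 : σ' 0 0 * x = 4 * σ 0 0) (h01 : σ' 0 0 * y + σ' 0 1 * w = 4 * σ 0 1)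
    (h10 : σ' 1 0 * x = σ 1 0) (h11 : σ' 1 0 * y + σ' 1 1 * w = σ 1 1) :
    quad (σ • τ) = σ' • ζ := by
  have hd := denomC_ne_zero σ τ
  have hd' := denomC_ne_zero σ' ζ
  rw [denomC] at hd hd'
  have hw' : (w : ℂ) ≠ 0 := by exact_mod_cast hw
  apply UpperHalfPlane.ext
  rw [coe_quad, coe_smul_eq, coe_smul_eq, ← mul_div_assoc, div_eq_div_iff hd hd']
  rw [hζ]
  have e00 : ((σ' 0 0 : ℤ) : ℂ) * x = 4 * (σ 0 0 : ℤ) := by exact_mod_cast h00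
  have e01 : ((σ' 0 0 : ℤ) : ℂ) * y + (σ' 0 1 : ℤ) * w = 4 * (σ 0 1 : ℤ) := by
    exact_mod_cast h01
  have e10 : ((σ' 1 0 : ℤ) : ℂ) * x = (σ 1 0 : ℤ) := by exact_mod_cast h10
  have e11 : ((σ' 1 0 : ℤ) : ℂ) * y + (σ' 1 1 : ℤ) * w = (σ 1 1 : ℤ) := by
    exact_mod_cast h11
  have e1 : ((σ' 0 0 : ℤ) : ℂ) * (((x : ℂ) * τ + y) / w) + (σ' 0 1 : ℤ) =
      (4 * ((σ 0 0 : ℤ) * τ + (σ 0 1 : ℤ))) / w := by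
    field_simp
    linear_combination (τ : ℂ) * e00 + e01
  have e2 : ((σ' 1 0 : ℤ) : ℂ) * (((x : ℂ) * τ + y) / w) + (σ' 1 1 : ℤ) =
      ((σ 1 0 : ℤ) * τ + (σ 1 1 : ℤ)) / w := by
    field_simp
    linear_combination (τ : ℂ) * e10 + e11
  rw [e1, e2]
  ring

theorem exists_quad_smul (σ : SL(2, ℤ)) : ∃ (σ' : SL(2, ℤ)) (ζ : ℍ → ℍ) (r : ℝ), 0 < r ∧
    (∀ τ, (ζ τ).im = r * τ.im) ∧ (∀ τ, quad (σ • τ) = σ' • ζ τ) ∧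
    (¬ 16 ∣ σ 1 0 → ((σ' 1 0 : ℤ) : ZMod 4) ≠ 0) := by
  set a := σ 0 0 with ha
  set b := σ 0 1 with hb
  set c := σ 1 0 with hc
  set d := σ 1 1 with hd
  have hdet : a * d - b * c = 1 := det_eq_one σ
  obtain ⟨x, w, hxw, c', hc', hcop, h16⟩ : ∃ x w : ℕ, x * w = 4 ∧ ∃ c' : ℤ, c = x * c' ∧
      IsCoprime ((w : ℤ) * a) c' ∧ (¬ 16 ∣ c → ¬ 4 ∣ c') := by
    have hac : IsCoprime a c := ⟨d, -b, by linarith⟩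
    rcases Int.emod_two_eq_zero_or_one c with h2 | h2
    · by_cases h4 : 4 ∣ c
      · obtain ⟨c', hc'⟩ := h4
        refine ⟨4, 1, rfl, c', by exact_mod_cast hc', ?_, ?_⟩
        · rw [hc'] at hac
          simpa using hac.of_mul_right_right
        · omega
      · obtain ⟨c', hc'⟩ := Int.dvd_of_emod_eq_zero h2
        refine ⟨2, 2, rfl, c', by exact_mod_cast hc', ?_, ?_⟩
        · rw [hc'] at hac
          refine IsCoprime.mul_left ?_ hac.of_mul_right_right
          refine (Int.isCoprime_iff_gcd_eq_one.2 ?_)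
          rcases Int.emod_two_eq_zero_or_one c' with h | h
          · omega
          · have := (Int.prime_two.coprime_iff_not_dvd (n := c')).2 (by omega)
            exact Int.isCoprime_iff_gcd_eq_one.1 (by exact_mod_cast this)
        · omega
    · refine ⟨1, 4, rfl, c, by simp, ?_, ?_⟩
      · refine IsCoprime.mul_left ?_ hac
        have := (Int.prime_two.coprime_iff_not_dvd (n := c)).2 (by omega)
        have := this.pow_left (m := 2)
        exact_mod_cast this
      · omega
  obtain ⟨u, v, huv⟩ := hcop
  have hx : x ≠ 0 := by rintro rfl; omega
  have hw : w ≠ 0 := by rintro rfl; omega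
  have hxw' : (x : ℤ) * w = 4 := by exact_mod_cast hxw
  let σ' : SL(2, ℤ) := ⟨!![w * a, -v; c', u], by rw [Matrix.det_fin_two_of]; linarith⟩
  let y : ℤ := 4 * u * b + v * d
  have him (τ : ℍ) : (((x : ℂ) * τ + y) / w).im = (x : ℝ) / w * τ.im := im_affine x w y τ
  have hr : 0 < (x : ℝ) / w := by positivity
  refine ⟨σ', fun τ => ⟨((x : ℂ) * τ + y) / w, by rw [him]; exact mul_pos hr τ.im_pos⟩, x / w, hr,
    him, fun τ => ?_, fun h => ?_⟩
  · refine quad_smul_eq σ σ' _ τ x w y hw rfl ?_ ?_ ?_ ?_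
    · change w * a * x = (4 * a)
      linear_combination a * hxw'
    · change w * a * y + -v * w = (4 * b)
      linear_combination 4 * b * huv + w * v * hdet + (b * v * c') * hxw' + w * v * b * hc'
    · change c' * x = c
      linear_combination -hc'
    · change c' * y + u * w = d
      linear_combination d * huv - u * w * hdet - u * w * b * hc' - u * b * c' * hxw'
  · change ((c' : ℤ) : ZMod 4) ≠ 0
    rw [Ne, ZMod.intCast_zmod_eq_zero_iff_dvd]
    exact_mod_cast h16 h

lemma quad_smul_of_dvd (γ : SL(2, ℤ)) (h : 16 ∣ γ 1 0) : ∃ γ' : SL(2, ℤ),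
    ((γ' 0 1 : ℤ) : ZMod 4) = 0 ∧ ((γ' 1 0 : ℤ) : ZMod 4) = 0 ∧
    ∀ τ, quad (γ • τ) = γ' • quad τ := by
  obtain ⟨k, hk⟩ := h
  have hdet := det_eq_one γ
  let γ' : SL(2, ℤ) := ⟨!![γ 0 0, 4 * γ 0 1; 4 * k, γ 1 1], by
    rw [Matrix.det_fin_two_of]; rw [hk] at hdet; linarith⟩
  refine ⟨γ', ?_, ?_, fun τ => ?_⟩
  · change ((4 * γ 0 1 : ℤ) : ZMod 4) = 0
    rw [ZMod.intCast_zmod_eq_zero_iff_dvd]; exact ⟨_, by push_cast; rfl⟩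
  · change ((4 * k : ℤ) : ZMod 4) = 0
    rw [ZMod.intCast_zmod_eq_zero_iff_dvd]; exact ⟨_, by push_cast; rfl⟩
  · refine quad_smul_eq γ γ' _ τ 4 1 0 one_ne_zero (by simp) ?_ ?_ ?_ ?_
    · change γ 0 0 * 4 = (4 * γ 0 0); ring
    · change γ 0 0 * 0 + 4 * γ 0 1 * 1 = (4 * γ 0 1); ring
    · change 4 * k * 4 = γ 1 0; rw [hk]; ring
    · change 4 * k * 0 + γ 1 1 * 1 = γ 1 1; ring

end Decomposition

section CuspGrowth

open Asymptotics

lemma exists_norm_theta_le : ∃ C : ℝ, 0 < C ∧ ∀ z : ℂ, 1 ≤ z.im →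
    ‖th₀ z - 1‖ ≤ C * rexp (-(π / 2) * z.im) ∧ ‖th₁ z‖ ≤ C * rexp (-(π / 2) * z.im) := by
  have hlt (x : ℝ) (hx : 0 < x) : 0 < 1 - rexp (-π * x) := by
    have : rexp (-π * x) < 1 := by
      rw [Real.exp_lt_one_iff]; nlinarith [Real.pi_pos]
    linarith
  have h1 := hlt (1 / 2) (by norm_num)
  have h2 := hlt (2 * 1) (by norm_num)
  refine ⟨2 / (1 - rexp (-π * (1 / 2))) + 2 / (1 - rexp (-π * (2 * 1))), by positivity,
    fun z hz => ?_⟩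
  have hexp : rexp (-π * (2 * z.im)) ≤ rexp (-(π / 2) * z.im) := by
    rw [Real.exp_le_exp]; nlinarith [Real.pi_pos]
  have hexp' : rexp (-π * (z.im / 2)) = rexp (-(π / 2) * z.im) := by congr 1; ring
  refine ⟨(norm_th₀_sub_one_le one_pos hz).trans ?_, (norm_th₁_le one_pos hz).trans ?_⟩
  · gcongr
    exact le_add_of_nonneg_left (by positivity)
  · rw [hexp', add_mul]
    gcongr

lemma norm_omegaCoeff (n : ZMod 4) : ‖omegaCoeff n‖ = 1 := by
  have : ∀ n : ZMod 4, n = 0 ∨ n = 1 ∨ n = 2 ∨ n = 3 := by decide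
  rcases this n with rfl | rfl | rfl | rfl <;> simp [omegaCoeff]

lemma isBigO_thetaForm_of_fst_eq_zero {v : ZMod 4 × ZMod 4} (hv : v.1 = 0) {l : Filter ℍ}
    {ζ : ℍ → ℍ} (hζ : Tendsto ζ l atImInfty) :
    (fun τ => thetaForm v (ζ τ)) =O[l] fun τ => rexp (-(π / 2) * (ζ τ).im) := by
  obtain ⟨C, hC, h⟩ := exists_norm_theta_le
  refine IsBigO.of_bound C ?_
  filter_upwards [hζ.eventually ((atImInfty_mem _).2 ⟨1, fun z hz => hz⟩ :
    {z : ℍ | 1 ≤ z.im} ∈ atImInfty)] with τ hτ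
  rw [thetaForm, if_pos hv, Real.norm_of_nonneg (Real.exp_pos _).le]
  exact (h _ hτ).2

lemma tendsto_thetaForm {v : ZMod 4 × ZMod 4} (hv : v.1 ≠ 0) :
    Tendsto (fun τ : ℍ => thetaForm v τ) atImInfty (𝓝 1) := by
  obtain ⟨C, hC, h⟩ := exists_norm_theta_le
  rw [tendsto_iff_norm_sub_tendsto_zero]
  have hlim : Tendsto (fun τ : ℍ => (C + C) * rexp (-(π / 2) * τ.im)) atImInfty (𝓝 0) := by
    have h1 : Tendsto (fun y : ℝ => (C + C) * rexp (-(π / 2) * y)) atTop (𝓝 ((C + C) * 0)) := by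
      refine Tendsto.const_mul _ (Real.tendsto_exp_atBot.comp ?_)
      exact tendsto_id.const_mul_atTop_of_neg (by linarith [Real.pi_pos])
    rw [mul_zero] at h1
    exact h1.comp tendsto_comap
  refine squeeze_zero' (Eventually.of_forall fun _ => norm_nonneg _) ?_ hlim
  filter_upwards [((atImInfty_mem _).2 ⟨1, fun z hz => hz⟩ :
    {z : ℍ | 1 ≤ z.im} ∈ atImInfty)] with τ hτ
  obtain ⟨h0, h1⟩ := h τ hτ
  have hE : 0 ≤ C * rexp (-(π / 2) * (τ : ℂ).im) := by positivity
  rw [thetaForm, if_neg hv]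
  split_ifs
  · refine h0.trans ?_
    rw [add_mul]
    exact le_add_of_nonneg_left hE
  · rw [add_sub_right_comm, add_mul]
    refine (norm_add_le _ _).trans (add_le_add h0 ?_)
    rwa [norm_mul, norm_omegaCoeff, one_mul]

lemma isBigO_thetaForm_one (v : ZMod 4 × ZMod 4) {l : Filter ℍ}
    {ζ : ℍ → ℍ} (hζ : Tendsto ζ l atImInfty) :
    (fun τ => thetaForm v (ζ τ)) =O[l] fun _ => (1 : ℝ) := by
  by_cases hv : v.1 = 0
  · refine (isBigO_thetaForm_of_fst_eq_zero hv hζ).trans (IsBigO.of_bound 1 ?_)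
    refine Eventually.of_forall fun τ => ?_
    rw [Real.norm_of_nonneg (Real.exp_pos _).le, norm_one, one_mul, Real.exp_le_one_iff]
    nlinarith [(ζ τ).im_pos, Real.pi_pos]
  · exact ((tendsto_thetaForm hv).comp hζ).isBigO_one ℝ

lemma isBigO_one_thetaForm {v : ZMod 4 × ZMod 4} (hv : v.1 ≠ 0) {l : Filter ℍ}
    {ζ : ℍ → ℍ} (hζ : Tendsto ζ l atImInfty) :
    (fun _ => (1 : ℝ)) =O[l] fun τ => thetaForm v (ζ τ) := by
  have := ((tendsto_thetaForm hv).comp hζ)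
  exact (isBigO_const_left_iff_pos_le_norm one_ne_zero).2 ⟨1 / 2, by norm_num,
    (this.norm.eventually (lt_mem_nhds (by norm_num : (1 / 2 : ℝ) < ‖(1 : ℂ)‖))).mono
      fun _ h => h.le⟩

/-- The quotient of a theta linear form by `th₁`, at the point `4τ`. -/
def thetaQuot (u : ZMod 4 × ZMod 4) (τ : ℍ) : ℂ := thetaForm u (quad τ) / th₁ (quad τ)

lemma isPrimMod4_zero_one : IsPrimMod4 (0, 1) := by unfold IsPrimMod4; decide

lemma th₁_ne_zero (z : ℍ) : th₁ z ≠ 0 := by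
  have := thetaForm_ne_zero isPrimMod4_zero_one z
  rwa [thetaForm, if_pos rfl] at this

/-- The quotient of modular units `2 th₀ / th₁` at `4τ`. -/
def thetaHaupt (τ : ℍ) : ℂ := 2 * th₀ (quad τ) / th₁ (quad τ)

/-- Vectors representing the six linear forms. -/
def formReps : Finset (ZMod 4 × ZMod 4) := {(0, 1), (2, 1), (1, 0), (1, 1), (1, 2), (1, 3)}

lemma thetaHaupt_poly_eq_prod (τ : ℍ) :
    thetaHaupt τ * (thetaHaupt τ ^ 4 - 16) = 32 * ∏ u ∈ formReps, thetaQuot u τ := by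
  have h := th₁_ne_zero (quad τ)
  have e1 : thetaQuot (0, 1) τ = 1 := by
    rw [thetaQuot, thetaForm, if_pos rfl, div_self h]
  have e2 : thetaQuot (2, 1) τ = th₀ (quad τ) / th₁ (quad τ) := by
    rw [thetaQuot, thetaForm, if_neg (show (2 : ZMod 4) ≠ 0 by decide), if_pos rfl]
  have e3 (w : ZMod 4) : thetaQuot (1, w) τ = th₀ (quad τ) / th₁ (quad τ) + omegaCoeff w := by
    rw [thetaQuot, thetaForm, if_neg (show (1 : ZMod 4) ≠ 0 by decide),
      if_neg (show (1 : ZMod 4) ≠ 2 by decide), one_mul, add_div, mul_div_cancel_right₀ _ h]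
  have o0 : omegaCoeff 0 = -1 := rfl
  have o1 : omegaCoeff 1 = -Complex.I := rfl
  have o2 : omegaCoeff 2 = 1 := rfl
  have o3 : omegaCoeff 3 = Complex.I := rfl
  rw [formReps]
  iterate 5 rw [Finset.prod_insert (by decide)]
  rw [Finset.prod_singleton, e1, e2, e3, e3, e3, e3, o0, o1, o2, o3, thetaHaupt, mul_div_assoc]
  set t := th₀ (quad τ) / th₁ (quad τ)
  linear_combination (32 * t * (t ^ 2 - 1)) * Complex.I_sq

lemma isPrimMod4_of_mem_formReps : ∀ u ∈ formReps, IsPrimMod4 u := by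
  unfold IsPrimMod4 formReps; decide

lemma thetaQuot_smul (σ σ' : SL(2, ℤ)) (ζ : ℍ → ℍ) (h : ∀ τ, quad (σ • τ) = σ' • ζ τ)
    {u : ZMod 4 × ZMod 4} (hu : IsPrimMod4 u) : ∃ c : ℂ, c ≠ 0 ∧ ∀ τ, thetaQuot u (σ • τ) =
      c * (thetaForm (actMod4 u σ') (ζ τ) * (thetaForm (actMod4 (0, 1) σ') (ζ τ))⁻¹) := by
  obtain ⟨j, hj, -, hform⟩ := permutesThetaForms σ'
  obtain ⟨c, hc, hcu⟩ := hform u hu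
  obtain ⟨c₁, hc₁, hc1⟩ := hform (0, 1) isPrimMod4_zero_one
  refine ⟨c * c₁⁻¹, mul_ne_zero hc (inv_ne_zero hc₁), fun τ => ?_⟩
  have e : th₁ ↑(σ' • ζ τ) = thetaForm (0, 1) ↑(σ' • ζ τ) := by rw [thetaForm, if_pos rfl]
  rw [thetaQuot, h, e, hcu, hc1]
  have := hj (ζ τ)
  have := thetaForm_ne_zero (isPrimMod4_zero_one.act σ') (ζ τ)
  field_simp

lemma thetaHaupt_eq (τ : ℍ) : thetaHaupt τ = 2 * thetaQuot (2, 1) τ := by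
  rw [thetaQuot, thetaForm, if_neg (show (2 : ZMod 4) ≠ 0 by decide), if_pos rfl, thetaHaupt,
    mul_div_assoc]

/-- `2 th₀/th₁ (4τ)` is invariant under `Γ₀(16)`. -/
theorem thetaHaupt_smul (γ : SL(2, ℤ)) (h : 16 ∣ γ 1 0) (τ : ℍ) :
    thetaHaupt (γ • τ) = thetaHaupt τ := by
  obtain ⟨γ', h01, h10, hq⟩ := quad_smul_of_dvd γ h
  obtain ⟨j, hj, -, hform⟩ := permutesThetaForms γ'
  have hdet : ((γ' 0 0 : ℤ) : ZMod 4) * ((γ' 1 1 : ℤ) : ZMod 4) = 1 := by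
    have := congrArg (Int.cast : ℤ → ZMod 4) (det_eq_one γ')
    push_cast at this
    rwa [h01, zero_mul, sub_zero] at this
  have hodd : ∀ x y : ZMod 4, x * y = 1 → 2 * x = 2 ∧ x ≠ 0 ∧ x ≠ 2 := by decide
  obtain ⟨ha, ha0, ha2⟩ := hodd _ _ hdet
  obtain ⟨c₁, hc₁, h1⟩ := hform (0, 1) isPrimMod4_zero_one
  obtain ⟨c₀, hc₀, h0⟩ := hform (2, 1) (by unfold IsPrimMod4; decide)
  obtain ⟨c₂, hc₂, h2⟩ := hform (1, 2) (by unfold IsPrimMod4; decide)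
  have e2 : omegaCoeff 2 = 1 := rfl
  simp only [actMod4, h01, h10, thetaForm, mul_zero, zero_mul, zero_add, add_zero, one_mul,
    if_true, ha, if_neg ha0, if_neg ha2, show (2 : ZMod 4) ≠ 0 by decide, if_false,
    show (1 : ZMod 4) ≠ 0 by decide, show (1 : ZMod 4) ≠ 2 by decide, e2] at h1 h0 h2
  have hprod : ((γ' 0 0 : ℤ) : ZMod 4) * (2 * ((γ' 1 1 : ℤ) : ZMod 4)) = 2 := by
    linear_combination 2 * hdet
  rw [hprod] at h2
  simp only [e2, one_mul] at h2
  have hlin (z : ℍ) : (c₀ - c₂) * th₀ z + (c₁ - c₂) * th₁ z = 0 := by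
    have := h2 z
    rw [h0, h1] at this
    apply mul_left_cancel₀ (hj z)
    linear_combination this
  have hc : c₁ - c₂ = 0 := by
    have e := hlin UpperHalfPlane.I
    have e' := hlin ((1 : ℝ) +ᵥ UpperHalfPlane.I)
    rw [show (((1 : ℝ) +ᵥ UpperHalfPlane.I : ℍ) : ℂ) = (UpperHalfPlane.I : ℍ) + 1 by
      rw [coe_vadd]; push_cast; ring, th₀_add_one, th₁_add_one UpperHalfPlane.I.im_pos] at e'
    have : (c₁ - c₂) * ((1 - Complex.I) * th₁ UpperHalfPlane.I) = 0 := by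
      linear_combination e - e'
    refine (mul_eq_zero.1 this).resolve_right (mul_ne_zero (fun h => ?_) (th₁_ne_zero _))
    simpa using congrArg Complex.re h
  have hc' : c₀ - c₂ = 0 := by
    have e := hlin UpperHalfPlane.I
    rw [hc, zero_mul, add_zero] at e
    refine (mul_eq_zero.1 e).resolve_right ?_
    have := thetaForm_ne_zero (v := (2, 1)) (by unfold IsPrimMod4; decide) UpperHalfPlane.I
    rwa [thetaForm, if_neg (show (2 : ZMod 4) ≠ 0 by decide), if_pos rfl] at this
  have hcc : c₀ = c₁ := by linear_combination hc' - hc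
  rw [thetaHaupt, hq, h0, h1, hcc, thetaHaupt]
  have := hj (quad τ)
  have := th₁_ne_zero (quad τ)
  field_simp

lemma tendsto_of_im_eq {ζ : ℍ → ℍ} {r : ℝ} (hr : 0 < r) (h : ∀ τ, (ζ τ).im = r * τ.im) :
    Tendsto ζ atImInfty atImInfty := by
  rw [atImInfty, tendsto_comap_iff]
  have : UpperHalfPlane.im ∘ ζ = fun τ => r * τ.im := funext h
  rw [this]
  exact tendsto_comap.const_mul_atTop hr

/-- Behaviour of the theta quotients at the cusps other than infinity. -/
theorem thetaQuot_growth (σ : SL(2, ℤ)) (h16 : ¬ 16 ∣ σ 1 0) :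
    ((fun τ => thetaHaupt (σ • τ)) =O[atImInfty] fun _ => (1 : ℝ)) ∧
    (∃ c : ℝ, 0 < c ∧ (fun τ => thetaHaupt (σ • τ) * (thetaHaupt (σ • τ) ^ 4 - 16))
      =O[atImInfty] fun τ => rexp (-c * τ.im)) ∧
    (fun τ => ‖denomC σ τ‖ ^ 2) =O[atImInfty] fun τ => th₁ (quad (σ • τ)) ^ 4 := by
  obtain ⟨σ', ζ, r, hr, him, hq, hσ'⟩ := exists_quad_smul σ
  have hζ := tendsto_of_im_eq hr him
  have hv : (actMod4 (0, 1) σ').1 ≠ 0 := by simpa [actMod4] using hσ' h16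
  have hinv : (fun τ => (thetaForm (actMod4 (0, 1) σ') (ζ τ))⁻¹) =O[atImInfty]
      fun _ => (1 : ℝ) := by
    have := (isBigO_one_thetaForm hv hζ).inv_rev (Eventually.of_forall fun _ h => by norm_num at h)
    simpa using this
  have hquot {u : ZMod 4 × ZMod 4} (hu : IsPrimMod4 u) {g : ℍ → ℝ}
      (hg : (fun τ => thetaForm (actMod4 u σ') (ζ τ)) =O[atImInfty] g) :
      (fun τ => thetaQuot u (σ • τ)) =O[atImInfty] g := by
    obtain ⟨c, -, hc⟩ := thetaQuot_smul σ σ' ζ hq hu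
    simp_rw [hc]
    simpa using (hg.mul hinv).const_mul_left c
  have hone {u : ZMod 4 × ZMod 4} (hu : IsPrimMod4 u) :
      (fun τ => thetaQuot u (σ • τ)) =O[atImInfty] fun _ => (1 : ℝ) :=
    hquot hu (isBigO_thetaForm_one _ hζ)
  refine ⟨?_, ⟨π / 2 * r, by positivity, ?_⟩, ?_⟩
  · simp_rw [thetaHaupt_eq]
    exact (hone (by unfold IsPrimMod4; decide)).const_mul_left 2
  · obtain ⟨u, hu, hu0⟩ : ∃ u ∈ formReps, (actMod4 u σ').1 = 0 := by
      have key : ∀ u : ZMod 4 × ZMod 4, ¬ (2 * u.1 = 0 ∧ 2 * u.2 = 0) →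
          u ∈ formReps ∨ -u ∈ formReps := by
        unfold formReps; decide
      have h1 : (actMod4 (actMod4 (0, 1) σ'⁻¹) σ').1 = 0 := by
        rw [← actMod4_mul, inv_mul_cancel, actMod4_one]
      rcases key _ (isPrimMod4_zero_one.act σ'⁻¹) with h | h
      · exact ⟨_, h, h1⟩
      · refine ⟨_, h, ?_⟩
        simp only [actMod4, Prod.fst_neg, Prod.snd_neg] at h1 ⊢
        linear_combination -h1
    simp_rw [thetaHaupt_poly_eq_prod, ← Finset.mul_prod_erase _ _ hu]
    refine IsBigO.const_mul_left ?_ 32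
    have h1 : (fun τ => thetaQuot u (σ • τ)) =O[atImInfty] fun τ => rexp (-(π / 2 * r) * τ.im) := by
      have := hquot (isPrimMod4_of_mem_formReps u hu) (isBigO_thetaForm_of_fst_eq_zero hu0 hζ)
      simp_rw [him] at this
      refine this.congr_right fun τ => ?_
      congr 1; ring
    have h2 : (fun τ => ∏ w ∈ formReps.erase u, thetaQuot w (σ • τ)) =O[atImInfty]
        fun _ => ∏ w ∈ formReps.erase u, (1 : ℝ) :=
      IsBigO.finsetProd fun w hw =>
        hone (isPrimMod4_of_mem_formReps w (Finset.mem_of_mem_erase hw))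
    simpa using h1.mul h2
  · obtain ⟨j, hj, ⟨κ, hκ, hjκ⟩, hform⟩ := permutesThetaForms σ'
    obtain ⟨c, hc, h⟩ := hform (0, 1) isPrimMod4_zero_one
    have e (τ : ℍ) : th₁ (quad (σ • τ)) = c * j (ζ τ) * thetaForm (actMod4 (0, 1) σ') (ζ τ) := by
      rw [hq, ← h, thetaForm, if_pos rfl]
    have hj4 (τ : ℍ) : ‖denomC σ τ‖ ^ 2 = 4 / (κ * r) * ‖j (ζ τ)‖ ^ 4 := by
      have h1 := hjκ (ζ τ)
      rw [← hq, im_quad, him] at h1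
      have h2 := im_smul_mul_norm_denomC σ τ
      have h3 := (σ • τ).im_pos
      field_simp
      apply mul_left_cancel₀ h3.ne'
      linear_combination (κ * r) * h2 - h1
    have hI : (fun τ => j (ζ τ) ^ 4) =O[atImInfty] fun τ => th₁ (quad (σ • τ)) ^ 4 := by
      have h1 : (fun _ => (1 : ℂ)) =O[atImInfty] fun τ => thetaForm (actMod4 (0, 1) σ') (ζ τ) :=
        (isBigO_norm_left (f' := fun _ => (1 : ℂ))).1 (by simpa using isBigO_one_thetaForm hv hζ)
      have h2 := (((isBigO_refl (fun τ => c * j (ζ τ)) atImInfty).mul h1).const_mul_left c⁻¹).pow 4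
      refine h2.congr (fun τ => ?_) fun τ => by rw [e]
      field_simp
    simp_rw [hj4]
    refine IsBigO.const_mul_left ?_ _
    simpa using hI.norm_left

end CuspGrowth

section Constancy

open Asymptotics ModularForm

lemma slash_zero_apply (g : ℍ → ℂ) (γ : SL(2, ℤ)) (τ : ℍ) : (g ∣[(0 : ℤ)] γ) τ = g (γ • τ) := by
  rw [ModularForm.SL_slash_apply, neg_zero, zpow_zero, mul_one]

/-- A holomorphic `Γ₀(16)`-invariant function bounded at the cusps and vanishing at infinity is
zero. -/
theorem eq_zero_of_gamma0_invariant {g : ℍ → ℂ} (hg : MDifferentiable 𝓘(ℂ) 𝓘(ℂ) g)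
    (hinv : ∀ γ : SL(2, ℤ), 16 ∣ γ 1 0 → ∀ τ, g (γ • τ) = g τ)
    (hbdd : ∀ σ : SL(2, ℤ), ¬ 16 ∣ σ 1 0 → (fun τ => g (σ • τ)) =O[atImInfty] fun _ => (1 : ℝ))
    (hzero : Tendsto g atImInfty (𝓝 0)) : g = 0 := by
  have hmem (γ : SL(2, ℤ)) : γ ∈ Gamma0 16 ↔ 16 ∣ γ 1 0 := by
    rw [Gamma0_mem, ZMod.intCast_zmod_eq_zero_iff_dvd]; rfl
  let F : ModularForm ((Gamma0 16 : Subgroup SL(2, ℤ)) : Subgroup (GL (Fin 2) ℝ)) 0 :=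
    { toFun := g
      slash_action_eq' := by
        rintro _ ⟨γ, hγ, rfl⟩
        funext τ
        exact (slash_zero_apply g γ τ).trans (hinv γ ((hmem γ).1 hγ) τ)
      holo' := hg
      bdd_at_cusps' := by
        intro c hc
        rw [Subgroup.IsArithmetic.isCusp_iff_isCusp_SL2Z] at hc
        refine (OnePoint.isBoundedAt_iff_forall_SL2Z hc).2 fun σ _ => ?_
        change (g ∣[(0 : ℤ)] σ) =O[atImInfty] (1 : ℍ → ℝ)
        rw [funext (slash_zero_apply g σ)]
        by_cases h : 16 ∣ σ 1 0
        · rw [funext (hinv σ h)]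
          exact hzero.isBigO_one ℝ
        · exact hbdd σ h }
  obtain ⟨c, hc⟩ := ModularForm.eq_const_of_weight_zero F
  change g = _ at hc
  rw [hc] at hzero
  have : c = 0 := tendsto_nhds_unique tendsto_const_nhds hzero
  rw [hc, this]; rfl

/-- Exponential growth at a cusp of a function with a cusp expansion. -/
theorem CuspExpansion.isBigO {k : ℝ} {f : ℍ → ℂ} {σ : SL(2, ℤ)} {M : ℕ} {c : ℤ → ℂ}
    (h : CuspExpansion k f σ M c) : ∃ C : ℝ,
    (fun τ => denomC σ τ ^ (-(k : ℂ)) * f (σ • τ)) =O[atImInfty] fun τ => rexp (C * τ.im) := by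
  obtain ⟨hM, ⟨s₀, hs₀⟩, h⟩ := h
  obtain ⟨hsum, hunif⟩ := h 1 one_pos
  have hM' : (0 : ℝ) < M := by exact_mod_cast hM
  set g : ℤ → ℝ := fun n => ‖c n * cexp (2 * π * Complex.I * n * (UpperHalfPlane.I : ℍ) / M)‖
  have hg : Summable g := hsum UpperHalfPlane.I (by simp)
  have hnorm (n : ℤ) (τ : ℍ) : ‖c n * cexp (2 * π * Complex.I * n * τ / M)‖ =
      ‖c n‖ * rexp (-(2 * π * n / M) * τ.im) := by
    rw [norm_mul, Complex.norm_exp, show 2 * π * Complex.I * n * τ / M =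
      ((2 * π * n / M : ℝ) : ℂ) * (Complex.I * τ) by push_cast; ring, re_ofReal_mul, I_mul_re,
      UpperHalfPlane.coe_im, mul_neg, neg_mul]
  refine ⟨2 * π * |s₀| / M, IsBigO.of_bound (∑' n, g n) ?_⟩
  filter_upwards [((atImInfty_mem _).2 ⟨1, fun z hz => hz⟩ :
    {z : ℍ | 1 ≤ z.im} ∈ atImInfty)] with τ (hτ : 1 ≤ τ.im)
  have hs : HasSum (fun n : ℤ => c n * cexp (2 * π * Complex.I * n * τ / M))
      (denomC σ τ ^ (-(k : ℂ)) * f (σ • τ)) := hunif.tendsto_at hτ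
  rw [← hs.tsum_eq, Real.norm_of_nonneg (Real.exp_pos _).le, ← tsum_mul_right]
  refine tsum_of_norm_bounded (hg.mul_right _).hasSum fun n => ?_
  rw [hnorm]
  simp only [g]
  rw [hnorm, mul_assoc (‖c n‖)]
  by_cases hn : n < s₀
  · simp [hs₀ n hn]
  refine mul_le_mul_of_nonneg_left ?_ (norm_nonneg (c n))
  rw [← Real.exp_add, Real.exp_le_exp]
  have hn' : -(n : ℝ) ≤ (|s₀| : ℤ) := by
    have : -n ≤ |s₀| := by have := neg_abs_le s₀; omega
    exact_mod_cast this
  have h2 : (0 : ℝ) ≤ (|s₀| : ℤ) := by exact_mod_cast abs_nonneg s₀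
  have hp : 0 < 2 * π / M := by positivity
  have : -(2 * π * n / M) * τ.im = (2 * π / M) * (-n * τ.im) := by ring
  rw [this]
  have : -(2 * π * n / M) * (UpperHalfPlane.I : ℍ).im + 2 * π * (|s₀| : ℤ) / M * τ.im =
    (2 * π / M) * (-n + (|s₀| : ℤ) * τ.im) := by simp; ring
  rw [this]
  refine mul_le_mul_of_nonneg_left ?_ hp.le
  nlinarith

lemma isBigO_pow_four_of_cuspExpansion {lam : ℕ} {f : ℍ → ℂ} {σ : SL(2, ℤ)} {M : ℕ} {c : ℤ → ℂ}
    (h : CuspExpansion ((lam : ℂ) + 1 / 2) f σ M c) : ∃ C : ℝ,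
    (fun τ => f (σ • τ) ^ 4) =O[atImInfty]
      fun τ => (‖denomC σ τ‖ ^ 2) ^ (2 * lam + 1) * rexp (C * τ.im) := by
  have hk : ((lam : ℂ) + 1 / 2) = ((lam + 1 / 2 : ℝ) : ℂ) := by push_cast; ring
  rw [hk] at h
  obtain ⟨C, hC⟩ := h.isBigO
  refine ⟨4 * C, ?_⟩
  have h4 := (isBigO_refl (fun τ => (‖denomC σ τ‖ ^ 2) ^ (2 * lam + 1)) atImInfty).mul
    (hC.norm_left.pow 4)
  refine IsBigO.of_norm_left (h4.congr (fun τ => ?_) fun τ => ?_)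
  · have hd := denomC_ne_zero σ τ
    have hd' : 0 < ‖denomC σ τ‖ := norm_pos_iff.2 hd
    rw [norm_mul, mul_pow, norm_pow, ← mul_assoc, ← ofReal_neg, Complex.norm_cpow_real,
      ← Real.rpow_natCast (_ ^ _) 4, ← Real.rpow_mul hd'.le]
    have : ‖denomC σ τ‖ ^ (-((lam : ℝ) + 1 / 2) * (4 : ℕ)) =
        ((‖denomC σ τ‖ ^ 2) ^ (2 * lam + 1))⁻¹ := by
      rw [← pow_mul, ← Real.rpow_natCast, ← Real.rpow_neg hd'.le]
      congr 1; push_cast; ring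
    rw [this, mul_inv_cancel₀ (by positivity), one_mul]
  · rw [← Real.exp_nat_mul]
    congr 2; push_cast; ring

end Constancy

section QExpansion

open Asymptotics

/-- The function `e^(2πinτ)`. -/
def qPow (n : ℤ) (τ : ℍ) : ℂ := cexp (2 * π * Complex.I * n * τ)

lemma qPow_add (m n : ℤ) (τ : ℍ) : qPow (m + n) τ = qPow m τ * qPow n τ := by
  rw [qPow, qPow, qPow, ← Complex.exp_add]
  congr 1; push_cast; ring

@[simp] lemma qPow_zero (τ : ℍ) : qPow 0 τ = 1 := by simp [qPow]

lemma qPow_quad (n : ℤ) (τ : ℍ) : qPow n (quad τ) = qPow (4 * n) τ := by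
  rw [qPow, qPow, coe_quad]
  congr 1; push_cast; ring

lemma norm_qPow (n : ℤ) (τ : ℍ) : ‖qPow n τ‖ = rexp (-(2 * π * n) * τ.im) := by
  rw [qPow, Complex.norm_exp, show 2 * π * Complex.I * n * τ =
    ((2 * π * n : ℝ) : ℂ) * (Complex.I * τ) by push_cast; ring, re_ofReal_mul, I_mul_re,
    UpperHalfPlane.coe_im, mul_neg, neg_mul]

lemma tendsto_qPow {n : ℤ} (hn : 0 < n) : Tendsto (qPow n) atImInfty (𝓝 0) := by
  rw [tendsto_zero_iff_norm_tendsto_zero]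
  simp_rw [norm_qPow]
  refine Real.tendsto_exp_atBot.comp ?_
  have : (0 : ℝ) < 2 * π * n := by have : (0 : ℝ) < n := by exact_mod_cast hn
                                   positivity
  exact tendsto_comap.const_mul_atTop_of_neg (by linarith)

lemma norm_qPow_le {n : ℤ} (hn : 0 ≤ n) {τ τ' : ℍ} (h : τ'.im ≤ τ.im) :
    ‖qPow n τ‖ ≤ ‖qPow n τ'‖ := by
  rw [norm_qPow, norm_qPow, Real.exp_le_exp, neg_mul, neg_mul, neg_le_neg_iff]
  have : (0 : ℝ) ≤ n := by exact_mod_cast hn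
  gcongr

/-- The Laurent series `φ` is the Fourier expansion of `f`. -/
def HasQExp (φ : LaurentSeries ℂ) (f : ℍ → ℂ) : Prop :=
  ∀ τ, HasSum (fun n : ℤ => φ.coeff n * qPow n τ) (f τ)

namespace HasQExp

variable {φ ψ : LaurentSeries ℂ} {f g : ℍ → ℂ}

lemma add (hf : HasQExp φ f) (hg : HasQExp ψ g) : HasQExp (φ + ψ) (fun τ => f τ + g τ) :=
  fun τ => ((hf τ).add (hg τ)).of_eq fun n => by rw [HahnSeries.coeff_add, add_mul]

lemma sub (hf : HasQExp φ f) (hg : HasQExp ψ g) : HasQExp (φ - ψ) (fun τ => f τ - g τ) :=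
  fun τ => ((hf τ).sub (hg τ)).of_eq fun n => by rw [HahnSeries.coeff_sub, sub_mul]

lemma C (c : ℂ) : HasQExp (HahnSeries.C c) fun _ => c := by
  intro τ
  convert hasSum_single (0 : ℤ) (f := fun n : ℤ => (HahnSeries.C c : LaurentSeries ℂ).coeff n *
    qPow n τ) (fun n hn => by simp [HahnSeries.C_apply, hn]) using 1
  simp

lemma zero : HasQExp 0 fun _ => 0 := by simpa using C 0

lemma one : HasQExp 1 fun _ => 1 := by simpa using C 1

lemma mul (hf : HasQExp φ f) (hg : HasQExp ψ g) : HasQExp (φ * ψ) (fun τ => f τ * g τ) := by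
  intro τ
  have h := ((Equiv.sigmaFiberEquiv fun x : ℤ × ℤ => x.1 + x.2).hasSum_iff.2
    ((hf τ).mul_complex (hg τ)))
  refine HasSum.sigma (g := fun n : ℤ => (φ * ψ).coeff n * qPow n τ) h fun n => ?_
  rw [HahnSeries.coeff_mul, Finset.sum_mul]
  have h2 := hasSum_sum_of_ne_finset_zero (L := .unconditional _) (f := fun x : {x : ℤ × ℤ // x.1 + x.2 = n} =>
    φ.coeff x.1.1 * qPow x.1.1 τ * (ψ.coeff x.1.2 * qPow x.1.2 τ))
    (s := (Finset.antidiagonal φ.isPWO_support ψ.isPWO_support n).preimage _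
      Subtype.val_injective.injOn) (fun x hx => by
        rw [Finset.mem_preimage, Finset.mem_antidiagonal] at hx
        by_cases h1 : φ.coeff x.1.1 = 0
        · simp [h1]
        by_cases h2 : ψ.coeff x.1.2 = 0
        · simp [h2]
        exact absurd ⟨h1, h2, x.2⟩ hx)
  refine (?_ : HasSum (fun x : {x : ℤ × ℤ // x.1 + x.2 = n} =>
    φ.coeff x.1.1 * qPow x.1.1 τ * (ψ.coeff x.1.2 * qPow x.1.2 τ)) _)
  convert h2 using 1
  rw [Finset.sum_preimage (f := (Subtype.val : {x : ℤ × ℤ // x.1 + x.2 = n} → ℤ × ℤ))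
    (g := fun x : ℤ × ℤ => φ.coeff x.1 * qPow x.1 τ * (ψ.coeff x.2 * qPow x.2 τ))]
  · refine Finset.sum_congr rfl fun x hx => ?_
    rw [← (Finset.mem_antidiagonal.1 hx).2.2, qPow_add]
    ring
  · intro x hx hx'
    exact absurd ⟨⟨x, (Finset.mem_antidiagonal.1 hx).2.2⟩, rfl⟩ hx'

lemma pow (hf : HasQExp φ f) (n : ℕ) : HasQExp (φ ^ n) (fun τ => f τ ^ n) := by
  induction n with
  | zero => simpa using one
  | succ n ih => simpa only [pow_succ] using ih.mul hf

lemma sum {ι : Type*} (s : Finset ι) {φ : ι → LaurentSeries ℂ} {f : ι → ℍ → ℂ}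
    (h : ∀ i ∈ s, HasQExp (φ i) (f i)) : HasQExp (∑ i ∈ s, φ i) (fun τ => ∑ i ∈ s, f i τ) := by
  classical
  induction s using Finset.induction_on with
  | empty => simpa using zero
  | insert i s hi ih =>
    simp only [Finset.sum_insert hi]
    exact (h i (by simp)).add (ih fun j hj => h j (by simp [hj]))

lemma quad (hf : HasQExp φ f) : HasQExp (qFour ℂ φ) (fun τ => f (quad τ)) := by
  intro τ
  have hinj : Function.Injective fun n : ℤ => 4 * n := fun a b h => by simpa using h
  refine (hinj.hasSum_iff fun n hn => ?_).1 ((hf (_root_.quad τ)).of_eq fun n => ?_)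
  · rw [qFour_coeff_of_not_dvd, zero_mul]
    rintro ⟨k, rfl⟩
    exact hn ⟨k, rfl⟩
  · rw [Function.comp_apply, qFour_coeff, qPow_quad]

lemma tendsto (hf : HasQExp φ f) {n₀ : ℤ} (h : ∀ n < n₀, φ.coeff n = 0) :
    Tendsto (fun τ => f τ * qPow (-n₀) τ) atImInfty (𝓝 (φ.coeff n₀)) := by
  have hs (τ : ℍ) : HasSum (fun n : ℤ => φ.coeff n * qPow (n - n₀) τ) (f τ * qPow (-n₀) τ) :=
    ((hf τ).mul_right _).of_eq fun n => by rw [mul_assoc, ← qPow_add, sub_eq_add_neg]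
  have hlim : ∑' n : ℤ, (if n = n₀ then φ.coeff n₀ else 0) = φ.coeff n₀ := tsum_ite_eq n₀ _
  rw [← hlim]
  simp_rw [← (hs _).tsum_eq]
  refine tendsto_tsum_of_dominated_convergence (hs UpperHalfPlane.I).summable.norm (fun n => ?_) ?_
  · split_ifs with hn
    · simp [hn]
    rcases lt_or_gt_of_ne hn with hn | hn
    · simp [h n hn]
    · simpa using (tendsto_qPow (by omega : 0 < n - n₀)).const_mul (φ.coeff n)
  · filter_upwards [((atImInfty_mem _).2 ⟨1, fun z hz => hz⟩ :
      {z : ℍ | 1 ≤ z.im} ∈ atImInfty)] with τ (hτ : 1 ≤ τ.im) n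
    by_cases hn : n < n₀
    · simp [h n hn]
    rw [norm_mul, norm_mul]
    exact mul_le_mul_of_nonneg_left (norm_qPow_le (by omega) (by simpa using hτ)) (norm_nonneg _)

lemma eq_zero (h : HasQExp φ fun _ => 0) : φ = 0 := by
  by_contra hne
  refine HahnSeries.coeff_order_eq_zero.not.2 hne ?_
  have := h.tendsto fun n hn => HahnSeries.coeff_eq_zero_of_lt_order hn
  simp only [zero_mul] at this
  exact tendsto_nhds_unique this tendsto_const_nhds

lemma unique (hf : HasQExp φ f) (hg : HasQExp ψ f) : φ = ψ := by
  rw [← sub_eq_zero]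
  exact eq_zero (by simpa using hf.sub hg)

end HasQExp

/-- The ring homomorphism of Laurent series obtained by mapping coefficients. -/
def laurentMap {R S : Type*} [CommRing R] [CommRing S] (f : R →+* S) :
    LaurentSeries R →+* LaurentSeries S where
  toFun x := x.map f
  map_zero' := by ext; simp
  map_one' := by ext n; simp [HahnSeries.coeff_one, apply_ite f]
  map_add' x y := by ext; simp
  map_mul' x y := HahnSeries.map_mul (f : R →ₙ+* S)

section

variable {R S : Type*} [CommRing R] [CommRing S] (f : R →+* S)

@[simp] lemma laurentMap_coeff (x : LaurentSeries R) (n : ℤ) :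
    (laurentMap f x).coeff n = f (x.coeff n) := rfl

lemma laurentMap_C (c : R) : laurentMap f (HahnSeries.C c) = HahnSeries.C (f c) :=
  HahnSeries.map_C c f

lemma laurentMap_qFour (x : LaurentSeries R) :
    laurentMap f (qFour R x) = qFour S (laurentMap f x) := by
  ext n
  by_cases hn : (4 : ℤ) ∣ n
  · obtain ⟨k, rfl⟩ := hn
    rw [laurentMap_coeff, qFour_coeff, qFour_coeff, laurentMap_coeff]
  · rw [laurentMap_coeff, qFour_coeff_of_not_dvd _ hn, qFour_coeff_of_not_dvd _ hn, map_zero]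

lemma laurentMap_injective {f : R →+* S} (hf : Function.Injective f) :
    Function.Injective (laurentMap f) := fun x y h => by
  ext n
  exact hf (congrArg (fun z : LaurentSeries S => z.coeff n) h)

end

end QExpansion

section IntegralTheta

/-- `x` is a Laurent series with leading term `q ^ n`. -/
def IsMonicAt {K : Type*} [CommRing K] (n : ℤ) (x : LaurentSeries K) : Prop :=
  (∀ k < n, x.coeff k = 0) ∧ x.coeff n = 1

section

variable {K : Type*} [CommRing K]

lemma coeff_mul_of_forall_lt {x y : LaurentSeries K} {i j : ℤ} (hx : ∀ k < i, x.coeff k = 0)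
    (hy : ∀ k < j, y.coeff k = 0) : (∀ k < i + j, (x * y).coeff k = 0) ∧
      (x * y).coeff (i + j) = x.coeff i * y.coeff j := by
  have key (k : ℤ) (hk : k ≤ i + j) (u v : ℤ) (hu : x.coeff u ≠ 0) (hv : y.coeff v ≠ 0)
      (huv : u + v = k) : u = i ∧ v = j := by
    have h1 : i ≤ u := by by_contra! h; exact hu (hx u h)
    have h2 : j ≤ v := by by_contra! h; exact hv (hy v h)
    omega
  constructor
  · intro k hk
    rw [HahnSeries.coeff_mul]
    refine Finset.sum_eq_zero fun p hp => ?_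
    obtain ⟨h1, h2, h3⟩ := Finset.mem_antidiagonal.1 hp
    obtain ⟨h4, h5⟩ := key k hk.le p.1 p.2 h1 h2 h3
    omega
  · rw [HahnSeries.coeff_mul]
    refine Finset.sum_eq_single (i, j) (fun p hp hne => ?_) fun h => ?_
    · obtain ⟨h1, h2, h3⟩ := Finset.mem_antidiagonal.1 hp
      exact absurd (Prod.ext_iff.2 (key _ le_rfl p.1 p.2 h1 h2 h3)) hne
    · by_contra hne
      exact h (Finset.mem_antidiagonal.2 ⟨left_ne_zero_of_mul hne, right_ne_zero_of_mul hne, rfl⟩)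

lemma IsMonicAt.mul {x y : LaurentSeries K} {i j : ℤ} (hx : IsMonicAt i x) (hy : IsMonicAt j y) :
    IsMonicAt (i + j) (x * y) := by
  obtain ⟨h1, h2⟩ := coeff_mul_of_forall_lt hx.1 hy.1
  exact ⟨h1, by rw [h2, hx.2, hy.2, one_mul]⟩

lemma IsMonicAt.one : IsMonicAt 0 (1 : LaurentSeries K) :=
  ⟨fun k hk => by simp [HahnSeries.coeff_one, hk.ne], by simp⟩

lemma IsMonicAt.pow {x : LaurentSeries K} {i : ℤ} (hx : IsMonicAt i x) (n : ℕ) :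
    IsMonicAt (n * i) (x ^ n) := by
  induction n with
  | zero => simpa using IsMonicAt.one
  | succ n ih =>
    rw [pow_succ, Nat.cast_succ, add_one_mul]
    exact ih.mul hx

lemma IsMonicAt.isUnit {x : LaurentSeries K} {i : ℤ} (hx : IsMonicAt i x) : IsUnit x := by
  nontriviality K
  have hne : x.coeff i ≠ 0 := by simp [hx.2]
  have hx0 : x ≠ 0 := by rintro rfl; simp at hne
  have ho : x.order = i := by
    refine le_antisymm (HahnSeries.order_le_of_coeff_ne_zero hne) ?_
    by_contra! h
    exact hx0 (HahnSeries.coeff_order_eq_zero.1 (hx.1 _ h))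
  refine HahnSeries.isUnit_of_isUnit_leadingCoeff_AddUnitOrder ?_ (AddGroup.isAddUnit _)
  rw [HahnSeries.leadingCoeff_eq, ho, hx.2]
  exact isUnit_one

lemma IsMonicAt.map {R : Type*} [CommRing R] {x : LaurentSeries R} {i : ℤ} (hx : IsMonicAt i x)
    (f : R →+* K) : IsMonicAt i (laurentMap f x) :=
  ⟨fun k hk => by rw [laurentMap_coeff, hx.1 k hk, map_zero],
    by rw [laurentMap_coeff, hx.2, map_one]⟩

end

section

variable {ι : Type*} {φ : ι → ℤ}

/-- The series `∑ q ^ φ(i)`. -/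
def countSeries (φ : ι → ℤ) (hφ : ∀ i, 0 ≤ φ i) : LaurentSeries ℤ :=
  HahnSeries.ofSuppBddBelow (fun n => (Nat.card {i // φ i = n} : ℤ)) ⟨0, fun n hn => by
    by_contra! h
    have : IsEmpty {i // φ i = n} := ⟨fun i => absurd (hφ i) (by rw [i.2]; omega)⟩
    exact hn (by simp)⟩

lemma countSeries_coeff (hφ : ∀ i, 0 ≤ φ i) (n : ℤ) :
    (countSeries φ hφ).coeff n = Nat.card {i // φ i = n} := rfl

lemma countSeries_coeff_eq_zero {hφ : ∀ i, 0 ≤ φ i} {n : ℤ} (h : ∀ i, φ i ≠ n) :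
    (countSeries φ hφ).coeff n = 0 := by
  have : IsEmpty {i // φ i = n} := ⟨fun i => h i i.2⟩
  simp [countSeries_coeff]

lemma countSeries_coeff_eq_one {hφ : ∀ i, 0 ≤ φ i} {n : ℤ} (i : ι) (hi : φ i = n)
    (h : ∀ j, φ j = n → j = i) : (countSeries φ hφ).coeff n = 1 := by
  have : Unique {i // φ i = n} := ⟨⟨i, hi⟩, fun j => Subtype.ext (h j j.2)⟩
  simp [countSeries_coeff]

lemma hasQExp_countSeries (hφ : ∀ i, 0 ≤ φ i) (hfin : ∀ n, Finite {i // φ i = n}) {f : ℍ → ℂ}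
    (hf : ∀ τ, HasSum (fun i => qPow (φ i) τ) (f τ)) :
    HasQExp (laurentMap (Int.castRingHom ℂ) (countSeries φ hφ)) f := by
  intro τ
  have h := (Equiv.sigmaFiberEquiv φ).hasSum_iff.2 (hf τ)
  refine HasSum.sigma (g := fun n : ℤ =>
    (laurentMap (Int.castRingHom ℂ) (countSeries φ hφ)).coeff n * qPow n τ) h fun n => ?_
  have := Fintype.ofFinite {i // φ i = n}
  refine (?_ : HasSum (fun i : {i // φ i = n} => qPow (φ i) τ) _)
  convert hasSum_fintype (L := .unconditional _) (fun i : {i // φ i = n} => qPow (φ i) τ) using 1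
  rw [Finset.sum_congr rfl fun i _ => by rw [i.2]]
  simp [countSeries_coeff]

end

/-- The theta constant `θ(4τ)`. -/
def thetaA (τ : ℍ) : ℂ := th₀ (quad τ)

/-- The theta constant `∑_{n ≥ 0} q^((2n+1)²)`. -/
def thetaB (τ : ℍ) : ℂ := th₁ (quad τ) / 2

/-- The `q`-expansion of `thetaA`. -/
def seriesA : LaurentSeries ℤ := countSeries (fun n : ℤ => 4 * n ^ 2) fun n => by positivity

/-- The `q`-expansion of `thetaB`. -/
def seriesB : LaurentSeries ℤ := countSeries (fun n : ℕ => (2 * n + 1 : ℤ) ^ 2) fun n => by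
  positivity

lemma isMonicAt_seriesA : IsMonicAt 0 seriesA := by
  refine ⟨fun k hk => countSeries_coeff_eq_zero fun i => ?_, countSeries_coeff_eq_one 0 rfl ?_⟩
  · nlinarith [sq_nonneg i]
  · intro j hj
    simpa using hj

lemma isMonicAt_seriesB : IsMonicAt 1 seriesB := by
  refine ⟨fun k hk => countSeries_coeff_eq_zero fun i => ?_, countSeries_coeff_eq_one 0 rfl ?_⟩
  · have := Int.natCast_nonneg i
    nlinarith
  · intro j hj
    have : (j : ℤ) = 0 := by nlinarith [sq_nonneg (j : ℤ)]
    exact_mod_cast this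

lemma seriesB_coeff_ne_zero {n : ℤ} (h : seriesB.coeff n ≠ 0) : (n : ZMod 4) = 1 := by
  by_contra hn
  refine h (countSeries_coeff_eq_zero fun i hi => hn ?_)
  rw [← hi]
  push_cast
  generalize (i : ZMod 4) = x
  revert x
  decide

lemma finite_of_abs_le {φ : ℤ → ℤ} (h : ∀ i, |i| ≤ φ i) (n : ℤ) : Finite {i // φ i = n} :=
  (Set.finite_Icc (-n) n).subset fun i (hi : φ i = n) => abs_le.1 (hi ▸ h i)

lemma hasQExp_thetaA : HasQExp (laurentMap (Int.castRingHom ℂ) seriesA) thetaA := by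
  refine hasQExp_countSeries _ (finite_of_abs_le fun i => ?_) fun τ =>
    (hasSum_th₀ (quad τ).im_pos).of_eq fun n => ?_
  · nlinarith [sq_abs i, abs_nonneg i, Int.le_self_sq |i|]
  · rw [qPow, coe_quad]
    congr 1; push_cast; ring

lemma hasQExp_thetaB : HasQExp (laurentMap (Int.castRingHom ℂ) seriesB) thetaB := by
  refine hasQExp_countSeries _ (fun n => ?_) fun τ =>
    (hasSum_nat_th₁ (quad τ).im_pos).of_eq fun n => ?_
  · refine (Set.finite_Iic n.toNat).subset fun i (hi : (2 * (i : ℤ) + 1) ^ 2 = n) => ?_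
    rw [Set.mem_Iic, ← hi]
    zify
    exact le_trans (by nlinarith) (Int.self_le_toNat _)
  · rw [qPow, coe_quad]
    congr 1; push_cast; ring

lemma thetaA_eq (τ : ℍ) : thetaA τ = thetaA (quad τ) + 2 * thetaB (quad τ) := by
  rw [thetaA, thetaA, thetaB, mul_div_cancel₀ _ two_ne_zero, th₀_add_th₁, th₀]
  congr 1
  simp only [coe_quad]
  ring

lemma thetaB_pow_four (τ : ℍ) : thetaB τ ^ 4 =
    thetaA (quad τ) * thetaB (quad τ) * (thetaA (quad τ) ^ 2 + 4 * thetaB (quad τ) ^ 2) := by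
  have h2 : 0 < (2 * (quad τ : ℂ)).im := im_two_mul_pos (quad τ).im_pos
  have e : 2 * (2 * (quad τ : ℂ)) = (quad (quad τ) : ℂ) := by simp only [coe_quad]; ring
  have hB : th₁ (quad τ) ^ 4 = 4 * (th₀ (2 * quad τ) ^ 2 * th₁ (2 * quad τ) ^ 2) := by
    rw [show 4 = 2 * 2 from rfl, pow_mul, th₁_sq (quad τ).im_pos]; ring
  rw [th₀_sq h2, th₁_sq h2, e] at hB
  rw [thetaA, thetaB, thetaB, div_pow, hB]
  ring

lemma seriesA_eq : seriesA = qFour ℤ (seriesA + 2 * seriesB) := by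
  refine laurentMap_injective (RingHom.injective_int (Int.castRingHom ℂ)) ?_
  rw [laurentMap_qFour, map_add, map_mul, map_ofNat, ← map_ofNat HahnSeries.C 2]
  refine hasQExp_thetaA.unique ?_
  rw [funext thetaA_eq]
  exact (hasQExp_thetaA.add ((HasQExp.C 2).mul hasQExp_thetaB)).quad

lemma seriesB_pow_four : seriesB ^ 4 = qFour ℤ (seriesA * seriesB *
    (seriesA ^ 2 + 4 * seriesB ^ 2)) := by
  refine laurentMap_injective (RingHom.injective_int (Int.castRingHom ℂ)) ?_
  rw [laurentMap_qFour]
  simp only [map_add, map_mul, map_pow, map_ofNat]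
  refine (hasQExp_thetaB.pow 4).unique ?_
  rw [funext thetaB_pow_four]
  have h := ((hasQExp_thetaA.mul hasQExp_thetaB).mul ((hasQExp_thetaA.pow 2).add
    ((HasQExp.C 4).mul (hasQExp_thetaB.pow 2)))).quad
  rw [map_ofNat HahnSeries.C 4] at h
  simpa only [map_add, map_mul, map_pow, map_ofNat] using h

/-- The pair of theta series with coefficients in a ring in which `2` is nilpotent. -/
def thetaPair (K : Type*) [CommRing K] (h2 : IsNilpotent (2 : K)) : ThetaPair K where
  a := (isMonicAt_seriesA.map (Int.castRingHom K)).isUnit.unit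
  b := (isMonicAt_seriesB.map (Int.castRingHom K)).isUnit.unit
  a_eq := by
    simp only [IsUnit.unit_spec]
    conv_lhs => rw [seriesA_eq, laurentMap_qFour]
    simp only [map_add, map_mul, map_ofNat]
  b_pow := by
    simp only [IsUnit.unit_spec]
    rw [← map_pow, seriesB_pow_four, laurentMap_qFour]
    simp only [map_add, map_mul, map_pow, map_ofNat]
  b_graded := by
    intro n hn
    rw [IsUnit.unit_spec, laurentMap_coeff] at hn
    exact seriesB_coeff_ne_zero fun h => hn (by rw [h, map_zero])
  nilp := h2

end IntegralTheta

section ThetaDecomposition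

open Asymptotics

lemma thetaB_ne_zero (τ : ℍ) : thetaB τ ≠ 0 := div_ne_zero (th₁_ne_zero _) two_ne_zero

lemma thetaHaupt_eq_div (τ : ℍ) : thetaHaupt τ = thetaA τ / thetaB τ := by
  rw [thetaHaupt, thetaA, thetaB]
  field_simp

lemma thetaA_eq_mul (τ : ℍ) : thetaA τ = thetaHaupt τ * thetaB τ := by
  rw [thetaHaupt_eq_div, div_mul_cancel₀ _ (thetaB_ne_zero τ)]

lemma Theta_eq (τ : ℍ) : Theta τ = th₀ (quad τ) + th₁ (quad τ) := by
  rw [th₀_add_th₁, Theta, (hasSum_th₀ τ.im_pos).tsum_eq, th₀]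
  congr 1
  simp only [coe_quad]
  ring

lemma Theta_eq_mul (τ : ℍ) : Theta τ = thetaB τ * (thetaHaupt τ + 2) := by
  rw [Theta_eq, mul_add, mul_comm, ← thetaA_eq_mul, thetaA, thetaB]
  ring

lemma Theta_ne_zero (τ : ℍ) : Theta τ ≠ 0 := by
  have h := thetaForm_ne_zero (v := (1, 2)) (by unfold IsPrimMod4; decide) (quad τ)
  rw [thetaForm, if_neg (show (1 : ZMod 4) ≠ 0 by decide),
    if_neg (show (1 : ZMod 4) ≠ 2 by decide), one_mul, show omegaCoeff 2 = 1 from rfl,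
    one_mul] at h
  rwa [Theta_eq]

lemma Theta_smul_div (γ : SL(2, ℤ)) (h : 16 ∣ γ 1 0) (τ : ℍ) :
    Theta (γ • τ) / Theta τ = thetaB (γ • τ) / thetaB τ := by
  have h0 := Theta_ne_zero τ
  rw [Theta_eq_mul] at h0
  rw [Theta_eq_mul, Theta_eq_mul, thetaHaupt_smul γ h,
    mul_div_mul_right _ _ (right_ne_zero_of_mul h0)]

lemma differentiableOn_thetaA : DifferentiableOn ℂ (thetaA ∘ ofComplex) {z | 0 < z.im} := by
  intro z hz
  have h : DifferentiableAt ℂ (fun w : ℂ => jacobiTheta (8 * w)) z := by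
    refine (differentiableAt_jacobiTheta ?_).comp z (by fun_prop)
    have : (8 * z).im = 8 * z.im := by simp
    rw [this]
    exact mul_pos (by norm_num) hz
  refine (h.differentiableWithinAt).congr (fun w hw => ?_) ?_ <;>
  · simp only [Function.comp_apply, thetaA, th₀, coe_quad]
    rw [ofComplex_apply_of_im_pos (by assumption)]
    congr 1
    simp only
    ring

lemma differentiableOn_thetaB : DifferentiableOn ℂ (thetaB ∘ ofComplex) {z | 0 < z.im} := by
  intro z hz
  have h : DifferentiableAt ℂ (fun w : ℂ => (jacobiTheta (2 * w) - jacobiTheta (8 * w)) / 2) z := by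
    refine DifferentiableAt.div_const (DifferentiableAt.sub
      ((differentiableAt_jacobiTheta ?_).comp z (by fun_prop))
      ((differentiableAt_jacobiTheta ?_).comp z (by fun_prop))) _
    · exact im_two_mul_pos hz
    · have : (8 * z).im = 8 * z.im := by simp
      rw [this]
      exact mul_pos (by norm_num) hz
  refine (h.differentiableWithinAt).congr (fun w hw => ?_) ?_ <;>
  · simp only [Function.comp_apply, thetaB, th₁, coe_quad]
    rw [ofComplex_apply_of_im_pos (by assumption)]
    congr 3 <;> (simp only; ring)

section Growth

variable {N : ℕ} {lam : ℕ} {f : ℍ → ℂ}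

lemma mem_gamma0_sixteen (γ : SL(2, ℤ)) : γ ∈ Gamma0 16 ↔ 16 ∣ γ 1 0 := by
  rw [Gamma0_mem, ZMod.intCast_zmod_eq_zero_iff_dvd]; rfl

lemma div_thetaB_pow_smul (hN : N ∣ 4) (hf : IsWeaklyHolo N (lam : ℤ) f) (γ : SL(2, ℤ))
    (h : 16 ∣ γ 1 0) (τ : ℍ) :
    f (γ • τ) / thetaB (γ • τ) ^ (2 * lam + 1) = f τ / thetaB τ ^ (2 * lam + 1) := by
  have hγ : γ ∈ Gamma0 (4 * N) := by
    rw [Gamma0_mem, ZMod.intCast_zmod_eq_zero_iff_dvd]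
    refine dvd_trans ?_ h
    exact_mod_cast mul_dvd_mul_left 4 hN
  have h1 := thetaB_ne_zero τ
  have h2 := thetaB_ne_zero (γ • τ)
  rw [hf.transf γ hγ, Theta_smul_div γ h,
    show (2 * (lam : ℤ) + 1) = ((2 * lam + 1 : ℕ) : ℤ) by push_cast; ring, _root_.zpow_natCast,
    div_pow]
  field_simp

lemma exists_isBigO_mul_pow (hf : IsWeaklyHolo N (lam : ℤ) f) (σ : SL(2, ℤ))
    (h16 : ¬ 16 ∣ σ 1 0) : ∃ e₀ : ℕ, ∀ e ≥ e₀, (fun τ => f (σ • τ) / thetaB (σ • τ) ^ (2 * lam + 1) *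
      (thetaHaupt (σ • τ) * (thetaHaupt (σ • τ) ^ 4 - 16)) ^ e) =O[atImInfty]
        fun _ => (1 : ℝ) := by
  obtain ⟨-, ⟨c, hc, hP⟩, hden⟩ := thetaQuot_growth σ h16
  obtain ⟨M, a, hM⟩ := hf.cusp σ
  rw [Int.cast_natCast] at hM
  obtain ⟨C, hC⟩ := isBigO_pow_four_of_cuspExpansion hM
  obtain ⟨e₀, he₀⟩ := exists_nat_ge (C / (4 * c))
  refine ⟨e₀, fun e he => ?_⟩
  have h1 : (fun τ => f (σ • τ) ^ 4) =O[atImInfty]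
      fun τ => (thetaB (σ • τ) ^ 4) ^ (2 * lam + 1) * (rexp (C * τ.im) : ℂ) := by
    refine hC.trans (IsBigO.mul (IsBigO.pow (hden.trans ?_) _) ?_)
    · refine (isBigO_const_mul_self 16 (fun τ => thetaB (σ • τ) ^ 4) atImInfty).congr_left
        fun τ => ?_
      rw [thetaB]; ring
    · exact IsBigO.of_norm_right (by simpa only [norm_real] using (isBigO_refl _ _).norm_right)
  have h2 : (fun τ => (f (σ • τ) / thetaB (σ • τ) ^ (2 * lam + 1)) ^ 4) =O[atImInfty]
      fun τ => (rexp (C * τ.im) : ℂ) := by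
    refine (h1.mul (isBigO_refl (fun τ => ((thetaB (σ • τ) ^ 4) ^ (2 * lam + 1))⁻¹) _)).congr
      (fun τ => ?_) fun τ => ?_
    · rw [div_pow, div_eq_mul_inv]; ring
    · have := thetaB_ne_zero (σ • τ)
      field_simp
  have h2' : (fun τ => (f (σ • τ) / thetaB (σ • τ) ^ (2 * lam + 1)) ^ 4) =O[atImInfty]
      fun τ => rexp (C * τ.im) :=
    h2.trans (IsBigO.of_norm_left (by simpa only [norm_real] using (isBigO_refl _ _).norm_left))
  have h3 := h2'.mul ((hP.pow e).pow 4)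
  refine IsBigO.of_pow (n := 4) (by norm_num) ?_
  refine (h3.congr_left fun τ => (mul_pow _ _ 4).symm).trans (IsBigO.of_bound 1 ?_)
  have he' : C ≤ 4 * c * e := by
    have : (e₀ : ℝ) ≤ e := by exact_mod_cast he
    rw [div_le_iff₀ (by positivity)] at he₀
    nlinarith
  filter_upwards with τ
  rw [← pow_mul, ← Real.exp_nat_mul, ← Real.exp_add, Real.norm_of_nonneg (Real.exp_pos _).le,
    Pi.pow_apply, one_pow, norm_one, one_mul, Real.exp_le_one_iff]
  push_cast
  nlinarith [τ.im_pos]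

lemma exists_uniform_isBigO (hN : N ∣ 4) (hf : IsWeaklyHolo N (lam : ℤ) f) : ∃ e : ℕ,
    ∀ σ : SL(2, ℤ), ¬ 16 ∣ σ 1 0 → (fun τ => f (σ • τ) / thetaB (σ • τ) ^ (2 * lam + 1) *
      (thetaHaupt (σ • τ) * (thetaHaupt (σ • τ) ^ 4 - 16)) ^ e) =O[atImInfty]
        fun _ => (1 : ℝ) := by
  have h (x : SL(2, ℤ) ⧸ Gamma0 16) : ∃ e₀ : ℕ, ¬ 16 ∣ (x.out⁻¹ : SL(2, ℤ)) 1 0 → ∀ e ≥ e₀,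
      (fun τ => f (x.out⁻¹ • τ) / thetaB (x.out⁻¹ • τ) ^ (2 * lam + 1) *
      (thetaHaupt (x.out⁻¹ • τ) * (thetaHaupt (x.out⁻¹ • τ) ^ 4 - 16)) ^ e) =O[atImInfty]
        fun _ => (1 : ℝ) := by
    by_cases hx : 16 ∣ (x.out⁻¹ : SL(2, ℤ)) 1 0
    · exact ⟨0, fun h => absurd hx h⟩
    · obtain ⟨e₀, he₀⟩ := exists_isBigO_mul_pow hf _ hx
      exact ⟨e₀, fun _ => he₀⟩
  choose E hE using h
  have : Fintype (SL(2, ℤ) ⧸ Gamma0 16) := Fintype.ofFinite _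
  refine ⟨Finset.univ.sup E, fun σ hσ => ?_⟩
  obtain ⟨γ, hγ⟩ := QuotientGroup.mk_out_eq_mul (Gamma0 16) σ⁻¹
  set x : SL(2, ℤ) ⧸ Gamma0 16 := QuotientGroup.mk σ⁻¹
  have hx : x.out⁻¹ = (γ⁻¹ : SL(2, ℤ)) * σ := by
    rw [hγ, _root_.mul_inv_rev, inv_inv]
  have hγ' : 16 ∣ (γ⁻¹ : SL(2, ℤ)) 1 0 := (mem_gamma0_sixteen _).1 (inv_mem γ.2)
  have hx16 : ¬ 16 ∣ (x.out⁻¹ : SL(2, ℤ)) 1 0 := by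
    rw [← mem_gamma0_sixteen] at hσ ⊢
    rw [hx]
    exact fun h => hσ (((Gamma0 16).mul_mem_cancel_left (inv_mem γ.2)).1 h)
  refine (hE x hx16 _ (Finset.le_sup (Finset.mem_univ x))).congr_left fun τ => ?_
  rw [hx, mul_smul, div_thetaB_pow_smul hN hf _ hγ', thetaHaupt_smul _ hγ']

end Growth

end ThetaDecomposition

section ThetaPolynomial

open Asymptotics

lemma exists_coeff_sub_sum_eq_zero {K : Type*} [CommRing K] {a b : LaurentSeries K}
    (ha : IsMonicAt 0 a) (hb : IsMonicAt 1 b) (d : ℕ) (G : LaurentSeries K)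
    (hG : ∀ k < 0, G.coeff k = 0) (n : ℕ) : ∃ c : ℕ → K, ∀ k : ℤ, k < n →
      (G - ∑ i ∈ Finset.range n, HahnSeries.C (c i) * a ^ (d - i) * b ^ i).coeff k = 0 := by
  induction n with
  | zero => exact ⟨0, fun k hk => by simpa using hG k (by simpa using hk)⟩
  | succ n ih =>
    obtain ⟨c, hc⟩ := ih
    set D := G - ∑ i ∈ Finset.range n, HahnSeries.C (c i) * a ^ (d - i) * b ^ i with hD
    refine ⟨Function.update c n (D.coeff n), fun k hk => ?_⟩
    have hmon : IsMonicAt n (a ^ (d - n) * b ^ n) := by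
      simpa using (ha.pow (d - n)).mul (hb.pow n)
    have hsum : G - ∑ i ∈ Finset.range (n + 1),
        HahnSeries.C (Function.update c n (D.coeff n) i) * a ^ (d - i) * b ^ i =
        D - HahnSeries.C (D.coeff n) * (a ^ (d - n) * b ^ n) := by
      rw [Finset.sum_range_succ, Function.update_self, hD, ← sub_sub, mul_assoc]
      congr 2
      refine Finset.sum_congr rfl fun i hi => ?_
      rw [Function.update_of_ne (Finset.mem_range.1 hi).ne]
    rw [hsum, HahnSeries.coeff_sub, HahnSeries.C_mul_eq_smul, HahnSeries.coeff_smul, smul_eq_mul]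
    rcases lt_or_eq_of_le (show k ≤ n by push_cast at hk; omega) with h | rfl
    · rw [hc k h, hmon.1 k h, mul_zero, sub_zero]
    · rw [hmon.2, mul_one, sub_self]

lemma HasQExp.laurentMap_mul_theta {R : Type*} [CommRing R] {ι : R →+* ℂ} {φ : LaurentSeries R}
    {f : ℍ → ℂ} (hφ : HasQExp (laurentMap ι φ) f) (e k d : ℕ) (c : ℕ → R) :
    HasQExp (laurentMap ι (φ * (laurentMap (Int.castRingHom R) seriesA *
      (laurentMap (Int.castRingHom R) seriesA ^ 4 -
        16 * laurentMap (Int.castRingHom R) seriesB ^ 4)) ^ e *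
        laurentMap (Int.castRingHom R) seriesB ^ k - ∑ i ∈ Finset.range (d + 1),
          HahnSeries.C (c i) * laurentMap (Int.castRingHom R) seriesA ^ (d - i) *
            laurentMap (Int.castRingHom R) seriesB ^ i))
      fun τ => f τ * (thetaA τ * (thetaA τ ^ 4 - 16 * thetaB τ ^ 4)) ^ e * thetaB τ ^ k -
        ∑ i ∈ Finset.range (d + 1), ι (c i) * thetaA τ ^ (d - i) * thetaB τ ^ i := by
  have hι (x : LaurentSeries ℤ) : laurentMap ι (laurentMap (Int.castRingHom R) x) =
      laurentMap (Int.castRingHom ℂ) x := by ext n; simp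
  simp only [map_sub, map_mul, map_pow, map_sum, hι, laurentMap_C, map_ofNat]
  rw [← map_ofNat HahnSeries.C 16]
  exact ((hφ.mul ((hasQExp_thetaA.mul ((hasQExp_thetaA.pow 4).sub
    ((HasQExp.C 16).mul (hasQExp_thetaB.pow 4)))).pow e)).mul (hasQExp_thetaB.pow k)).sub
      (HasQExp.sum _ fun i _ => ((HasQExp.C _).mul (hasQExp_thetaA.pow _)).mul
        (hasQExp_thetaB.pow _))

lemma tendsto_div_thetaB_pow {φ : LaurentSeries ℂ} {g : ℍ → ℂ} (hg : HasQExp φ g) {d : ℕ}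
    (h : ∀ n : ℤ, n < d + 1 → φ.coeff n = 0) :
    Tendsto (fun τ => g τ / thetaB τ ^ d) atImInfty (𝓝 0) := by
  have hB := hasQExp_thetaB.tendsto (n₀ := 1) fun n hn =>
    (isMonicAt_seriesB.map (Int.castRingHom ℂ)).1 n hn
  rw [(isMonicAt_seriesB.map (Int.castRingHom ℂ)).2] at hB
  have hlim := ((hg.tendsto h).div (hB.pow d) (by simp)).mul (tendsto_qPow one_pos)
  rw [mul_zero] at hlim
  refine hlim.congr fun τ => ?_
  have h1 : qPow (-((d : ℤ) + 1)) τ * qPow 1 τ = qPow (-1) τ ^ d := by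
    rw [← qPow_add]
    simp only [qPow]
    rw [← Complex.exp_nat_mul]
    congr 1; push_cast; ring
  have h2 : qPow (-1) τ ≠ 0 := Complex.exp_ne_zero _
  simp only [Pi.div_apply]
  rw [mul_pow, ← h1]
  have h3 := thetaB_ne_zero τ
  have h4 : qPow (-((d : ℤ) + 1)) τ ≠ 0 := Complex.exp_ne_zero _
  have h5 : qPow 1 τ ≠ 0 := Complex.exp_ne_zero _
  field_simp

/-- A weakly holomorphic form of half-integral weight is, up to a power of the discriminant-like
form `a(a⁴ - 16b⁴)`, a polynomial in the theta series `a`, `b`. -/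
theorem exists_theta_polynomial {N lam : ℕ} {f : ℍ → ℂ} (hN : N ∣ 4)
    (hf : IsWeaklyHolo N (lam : ℤ) f) {R : Type*} [CommRing R] {ι : R →+* ℂ}
    (hι : Function.Injective ι) {φ : LaurentSeries R} (hφ : HasQExp (laurentMap ι φ) f) :
    ∃ (e k : ℕ) (c : ℕ → R), φ * (laurentMap (Int.castRingHom R) seriesA *
      (laurentMap (Int.castRingHom R) seriesA ^ 4 -
        16 * laurentMap (Int.castRingHom R) seriesB ^ 4)) ^ e *
        laurentMap (Int.castRingHom R) seriesB ^ k =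
      ∑ i ∈ Finset.range (2 * lam + 1 + 5 * e + k + 1), HahnSeries.C (c i) *
        laurentMap (Int.castRingHom R) seriesA ^ (2 * lam + 1 + 5 * e + k - i) *
          laurentMap (Int.castRingHom R) seriesB ^ i := by
  obtain ⟨e, he⟩ := exists_uniform_isBigO hN hf
  set k := φ.order.natAbs
  set d := 2 * lam + 1 + 5 * e + k with hd
  have hA := isMonicAt_seriesA.map (Int.castRingHom R)
  have hB := isMonicAt_seriesB.map (Int.castRingHom R)
  have hG : ∀ j < 0, (φ * (laurentMap (Int.castRingHom R) seriesA *
      (laurentMap (Int.castRingHom R) seriesA ^ 4 -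
        16 * laurentMap (Int.castRingHom R) seriesB ^ 4)) ^ e *
        laurentMap (Int.castRingHom R) seriesB ^ k).coeff j = 0 := by
    have hφ0 (j : ℤ) (hj : j < -k) : φ.coeff j = 0 :=
      HahnSeries.coeff_eq_zero_of_lt_order (by omega)
    have hdelta : ∀ j < 0, (laurentMap (Int.castRingHom R) seriesA *
        (laurentMap (Int.castRingHom R) seriesA ^ 4 -
          16 * laurentMap (Int.castRingHom R) seriesB ^ 4)).coeff j = 0 := by
      refine (coeff_mul_of_forall_lt hA.1 (j := 0) fun j hj => ?_).1
      rw [← map_ofNat HahnSeries.C 16, HahnSeries.coeff_sub, HahnSeries.C_mul_eq_smul,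
        HahnSeries.coeff_smul, (hA.pow 4).1 j (by simpa using hj), (hB.pow 4).1 j (by push_cast; omega),
        smul_zero, sub_zero]
    have hdelta_pow : ∀ m : ℕ, ∀ j < 0, ((laurentMap (Int.castRingHom R) seriesA *
        (laurentMap (Int.castRingHom R) seriesA ^ 4 -
          16 * laurentMap (Int.castRingHom R) seriesB ^ 4)) ^ m).coeff j = 0 := by
      intro m
      induction m with
      | zero =>
        intro j hj
        rw [pow_zero, HahnSeries.coeff_one, if_neg hj.ne]
      | succ m ih =>
        rw [pow_succ]
        exact (coeff_mul_of_forall_lt ih hdelta).1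
    intro j hj
    exact (coeff_mul_of_forall_lt (coeff_mul_of_forall_lt hφ0 (hdelta_pow e)).1 (hB.pow k).1).1 j
      (by simpa using hj)
  obtain ⟨c, hc⟩ := exists_coeff_sub_sum_eq_zero hA hB d _ hG (d + 1)
  refine ⟨e, k, c, ?_⟩
  rw [← sub_eq_zero]
  refine laurentMap_injective hι ?_
  rw [map_zero]
  have hq := hφ.laurentMap_mul_theta e k d c
  set D := φ * (laurentMap (Int.castRingHom R) seriesA *
      (laurentMap (Int.castRingHom R) seriesA ^ 4 -
        16 * laurentMap (Int.castRingHom R) seriesB ^ 4)) ^ e *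
        laurentMap (Int.castRingHom R) seriesB ^ k - ∑ i ∈ Finset.range (d + 1),
          HahnSeries.C (c i) * laurentMap (Int.castRingHom R) seriesA ^ (d - i) *
            laurentMap (Int.castRingHom R) seriesB ^ i
  set g : ℍ → ℂ := fun τ => f τ * (thetaA τ * (thetaA τ ^ 4 - 16 * thetaB τ ^ 4)) ^ e *
    thetaB τ ^ k - ∑ i ∈ Finset.range (d + 1), ι (c i) * thetaA τ ^ (d - i) * thetaB τ ^ i with hg
  have hquot (τ : ℍ) : g τ / thetaB τ ^ d = f τ / thetaB τ ^ (2 * lam + 1) *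
      (thetaHaupt τ * (thetaHaupt τ ^ 4 - 16)) ^ e -
        ∑ i ∈ Finset.range (d + 1), ι (c i) * thetaHaupt τ ^ (d - i) := by
    have hb := thetaB_ne_zero τ
    rw [div_eq_iff (pow_ne_zero _ hb), hg, sub_mul, Finset.sum_mul]
    simp only [thetaA_eq_mul]
    congr 1
    · have h5 : thetaHaupt τ * thetaB τ * ((thetaHaupt τ * thetaB τ) ^ 4 - 16 * thetaB τ ^ 4) =
          thetaB τ ^ 5 * (thetaHaupt τ * (thetaHaupt τ ^ 4 - 16)) := by ring
      have h6 : thetaB τ ^ d = thetaB τ ^ (2 * lam + 1) * (thetaB τ ^ 5) ^ e * thetaB τ ^ k := by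
        rw [hd]; ring
      rw [h5, h6, mul_pow (thetaB τ ^ 5)]
      field_simp
    · refine Finset.sum_congr rfl fun i hi => ?_
      rw [← pow_sub_mul_pow (thetaB τ) (show i ≤ d by simp at hi; omega)]
      ring
  have hzero : (fun τ => g τ / thetaB τ ^ d) = 0 := by
    refine eq_zero_of_gamma0_invariant ?_ (fun γ hγ τ => ?_) (fun σ hσ => ?_)
      (tendsto_div_thetaB_pow hq fun n hn => ?_)
    · rw [UpperHalfPlane.mdifferentiable_iff]
      have h1 := UpperHalfPlane.mdifferentiable_iff.1 hf.holo
      have h2 := differentiableOn_thetaA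
      have h3 := differentiableOn_thetaB
      have h4 : ∀ z ∈ {z : ℂ | 0 < z.im}, (thetaB ∘ ofComplex) z ^ d ≠ 0 :=
        fun z _ => pow_ne_zero _ (thetaB_ne_zero _)
      refine DifferentiableOn.div ?_ (h3.pow d) h4
      refine (((h1.mul ((h2.mul ((h2.pow 4).sub ((h3.pow 4).const_mul 16))).pow e)).mul
        (h3.pow k))).sub (DifferentiableOn.fun_sum fun i _ => ?_)
      exact ((h2.pow (d - i)).const_mul (ι (c i))).mul (h3.pow i)
    · simp only [hquot, div_thetaB_pow_smul hN hf γ hγ, thetaHaupt_smul γ hγ]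
    · simp only [hquot]
      refine (he σ hσ).sub (IsBigO.fun_sum fun i _ => ?_)
      simpa using ((thetaQuot_growth σ hσ).1.pow (d - i)).const_mul_left (ι (c i))
    · rw [laurentMap_coeff, hc n (by exact_mod_cast hn), map_zero]
  refine HasQExp.eq_zero fun τ => ?_
  have : g τ = 0 := by
    simpa [thetaB_ne_zero] using congrFun hzero τ
  rw [← this]
  exact hq τ

end ThetaPolynomial

section CuspAtInfinity

lemma cuspExpansion_one {k : ℂ} {f : ℍ → ℂ} {a : ℤ → ℂ} (ha : FourierAtInfty f a) {n₀ : ℤ}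
    (hvan : ∀ n : ℤ, n < n₀ → a n = 0) : CuspExpansion k f 1 1 a := by
  refine ⟨one_pos, ⟨n₀, hvan⟩, fun y₀ hy₀ => ?_⟩
  have hq (n : ℤ) (τ : ℍ) : cexp (2 * π * Complex.I * n * τ / (1 : ℕ)) = qPow n τ := by
    rw [Nat.cast_one, div_one, qPow]
  have hf (τ : ℍ) : denomC 1 τ ^ (-k) * f ((1 : SL(2, ℤ)) • τ) = ∑' n, a n * qPow n τ := by
    rw [one_smul, (ha τ).tsum_eq.symm]
    simp [denomC, qPow]
  simp only [hq, hf]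
  refine ⟨fun τ _ => (ha τ).summable.norm, ?_⟩
  let τ₀ : ℍ := ⟨y₀ * Complex.I, by simpa using hy₀⟩
  refine tendstoUniformlyOn_tsum_of_cofinite_eventually (ha τ₀).summable.norm ?_
  refine (Set.finite_Ico n₀ 0).subset fun n hn => ?_
  by_contra hn'
  refine hn fun τ hτ => ?_
  by_cases h : n < n₀
  · simp [hvan n h]
  change ‖a n * qPow n τ‖ ≤ ‖a n * qPow n τ₀‖
  rw [norm_mul, norm_mul]
  refine mul_le_mul_of_nonneg_left (norm_qPow_le ?_ ?_) (norm_nonneg _)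
  · rw [Set.mem_Ico] at hn'; omega
  · have : τ₀.im = y₀ := by simp [τ₀, UpperHalfPlane.im]
    rw [this]; exact hτ

end CuspAtInfinity

section PIntegralRing

variable (L : Subfield ℂ) (P : Ideal (𝓞 L))

/-- The ring of `P`-integral complex numbers. -/
def pIntegralRing [P.IsPrime] : Subring ℂ where
  carrier := {x | PIntegral L P x}
  mul_mem' := by
    rintro x y ⟨a, b, hb, h⟩ ⟨a', b', hb', h'⟩
    exact ⟨a * a', b * b', (Ideal.IsPrime.mul_notMem ‹_› hb hb'), by
      push_cast
      linear_combination (y * ((b' : L) : ℂ)) * h + ((a : L) : ℂ) * h'⟩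
  one_mem' := ⟨1, 1, (Ideal.ne_top_iff_one P).1 (Ideal.IsPrime.ne_top ‹_›), by simp⟩
  add_mem' := by
    rintro x y ⟨a, b, hb, h⟩ ⟨a', b', hb', h'⟩
    exact ⟨a * b' + a' * b, b * b', (Ideal.IsPrime.mul_notMem ‹_› hb hb'), by
      push_cast
      linear_combination ((b' : L) : ℂ) * h + ((b : L) : ℂ) * h'⟩
  zero_mem' := ⟨0, 1, (Ideal.ne_top_iff_one P).1 (Ideal.IsPrime.ne_top ‹_›), by simp⟩
  neg_mem' := by
    rintro x ⟨a, b, hb, h⟩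
    exact ⟨-a, b, hb, by push_cast; linear_combination -h⟩

/-- The ideal of `P`-integral numbers of valuation at least `j`. -/
def pIntegralIdeal [P.IsPrime] (j : ℕ) : Ideal (pIntegralRing L P) where
  carrier := {x | CongMod L P j (x : ℂ) 0}
  zero_mem' := ⟨0, 1, zero_mem _, (Ideal.ne_top_iff_one P).1 (Ideal.IsPrime.ne_top ‹_›), by simp⟩
  add_mem' := by
    rintro x y ⟨a, b, ha, hb, h⟩ ⟨a', b', ha', hb', h'⟩
    refine ⟨a * b' + a' * b, b * b', add_mem (Ideal.mul_mem_right _ _ ha)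
      (Ideal.mul_mem_right _ _ ha'), Ideal.IsPrime.mul_notMem ‹_› hb hb', ?_⟩
    push_cast
    linear_combination ((b' : L) : ℂ) * h + ((b : L) : ℂ) * h'
  smul_mem' := by
    rintro ⟨x, a, b, hb, h⟩ y ⟨a', b', ha', hb', h'⟩
    refine ⟨a * a', b * b', Ideal.mul_mem_left _ _ ha', Ideal.IsPrime.mul_notMem ‹_› hb hb', ?_⟩
    rw [smul_eq_mul, Subring.coe_mul]
    push_cast
    linear_combination ((y : ℂ) * ((b' : L) : ℂ)) * h + ((a : L) : ℂ) * h'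

variable {L P} [P.IsPrime]

lemma pIntegralIdeal_one_pow_le (j : ℕ) : pIntegralIdeal L P 1 ^ j ≤ pIntegralIdeal L P j := by
  induction j with
  | zero =>
    rintro ⟨x, a, b, hb, h⟩ -
    exact ⟨a, b, by simp, hb, by rwa [sub_zero]⟩
  | succ j ih =>
    rw [pow_succ, Ideal.mul_le]
    rintro x hx y ⟨a', b', ha', hb', h'⟩
    obtain ⟨a, b, ha, hb, h⟩ := ih hx
    rw [pow_one] at ha'
    refine ⟨a * a', b * b', pow_succ P j ▸ Ideal.mul_mem_mul ha ha',
      Ideal.IsPrime.mul_notMem ‹_› hb hb', ?_⟩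
    rw [Subring.coe_mul]
    push_cast
    linear_combination ((y : ℂ) * ((b' : L) : ℂ)) * h + ((a : L) : ℂ) * h'

lemma two_mem_pIntegralIdeal (h2 : (2 : 𝓞 L) ∈ P) : 2 ∈ pIntegralIdeal L P 1 :=
  ⟨2, 1, by rwa [pow_one], (Ideal.ne_top_iff_one P).1 (Ideal.IsPrime.ne_top ‹_›), by
    have h : ((2 : 𝓞 L) : L) = 2 := map_ofNat (algebraMap (𝓞 L) L) 2
    have h' : ((1 : 𝓞 L) : L) = 1 := map_one (algebraMap (𝓞 L) L)
    rw [sub_zero, h, h', OneMemClass.coe_one, mul_one]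
    exact (map_ofNat (pIntegralRing L P).subtype 2).trans (map_ofNat L.subtype 2).symm⟩

lemma laurentMap_laurentMap {R S T : Type*} [CommRing R] [CommRing S] [CommRing T] (g : S →+* T)
    (f : R →+* S) (x : LaurentSeries R) :
    laurentMap g (laurentMap f x) = laurentMap (g.comp f) x := by
  ext n
  simp

end PIntegralRing

/-- Let `N ∈ {1,2,4}`, `λ ≥ 0`, and let `f` be a weakly holomorphic modular
form of weight `λ + 1/2` on `Γ₀(4N)` whose Fourier coefficients at `∞` lie in `L` and are
`𝔭`-integral, where `𝔭 ∣ 2`, and whose constant term at every cusp vanishes. Then for every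
`j ≥ 1` there is `b ≥ 1` with `a_f(2^b n) ≡ 0 (mod 𝔭^j)` for every integer `n`. -/
theorem statement0
    (N : ℕ) (hN : N = 1 ∨ N = 2 ∨ N = 4) (lam : ℕ)
    (L : Subfield ℂ) [NumberField L]
    (P : Ideal (𝓞 L)) (hPprime : P.IsPrime) (hP2 : (2 : 𝓞 L) ∈ P)
    (f : ℍ → ℂ) (hf : IsWeaklyHolo N (lam : ℤ) f)
    (a : ℤ → ℂ) (ha : FourierAtInfty f a)
    (n₀ : ℤ) (hvan : ∀ n : ℤ, n < n₀ → a n = 0)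
    (haL : ∀ n : ℤ, a n ∈ L)
    (haInt : ∀ n : ℤ, PIntegral L P (a n))
    (hconst : ∀ (σ : SL(2, ℤ)) (M : ℕ) (c : ℤ → ℂ),
      CuspExpansion ((lam : ℂ) + 1 / 2) f σ M c → c 0 = 0) :
    ∀ j : ℕ, 0 < j → ∃ b : ℕ, 0 < b ∧ ∀ n : ℤ, CongMod L P j (a (2 ^ b * n)) 0 := by
  intro j _
  have hN4 : N ∣ 4 := by rcases hN with rfl | rfl | rfl <;> norm_num
  have ha0 : a 0 = 0 := hconst 1 1 a (cuspExpansion_one ha hvan)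
  let R := pIntegralRing L P
  let φ : LaurentSeries R := HahnSeries.ofSuppBddBelow (fun n => (⟨a n, haInt n⟩ : R))
    ⟨n₀, fun n hn => not_lt.1 fun h => hn (Subtype.ext (hvan n h))⟩
  have hφ : HasQExp (laurentMap R.subtype φ) f := by
    intro τ
    simp only [laurentMap_coeff]
    exact ha τ
  obtain ⟨e, k, c, hc⟩ := exists_theta_polynomial hN4 hf Subtype.val_injective hφ
  let K := R ⧸ pIntegralIdeal L P j
  let q : R →+* K := Ideal.Quotient.mk _
  have hI : Ideal.map q (pIntegralIdeal L P 1) ^ j = ⊥ := by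
    rw [← Ideal.map_pow, Ideal.map_eq_bot_iff_le_ker, Ideal.mk_ker]
    exact pIntegralIdeal_one_pow_le j
  have h2 : (2 : K) ∈ Ideal.map q (pIntegralIdeal L P 1) :=
    map_ofNat q 2 ▸ Ideal.mem_map_of_mem q (two_mem_pIntegralIdeal hP2)
  have hnil : IsNilpotent (2 : K) := ⟨j, by
    rw [← Ideal.mem_bot, ← hI]
    exact Ideal.pow_mem_pow h2 j⟩
  obtain ⟨b, hb⟩ := (thetaPair K hnil).exists_coeff_four_pow_mul_eq_zero (2 * lam + 1) h2 hI
    (by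
      have := ((isMonicAt_seriesA.map (Int.castRingHom K)).pow (2 * lam + 1)).2
      rwa [mul_zero] at this)
    (laurentMap q φ) e k (fun i => q (c i))
    (by
      have := congrArg (laurentMap q) hc
      simp only [map_sub, map_mul, map_pow, map_sum, laurentMap_C, map_ofNat,
        laurentMap_laurentMap, RingHom.ext_int (q.comp (Int.castRingHom R)) (Int.castRingHom K)]
        at this
      exact this)
    (by
      rw [laurentMap_coeff]
      have : φ.coeff 0 = 0 := Subtype.ext ha0
      rw [this, map_zero])
  refine ⟨2 * (b + 1), by omega, fun n => ?_⟩
  have := hb (4 * n)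
  rw [laurentMap_coeff, Ideal.Quotient.eq_zero_iff_mem] at this
  have hn : (2 : ℤ) ^ (2 * (b + 1)) * n = 4 ^ b * (4 * n) := by
    rw [pow_mul, pow_succ]; ring
  rw [hn]
  exact this

end
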